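/- arXiv:1409.6215 — 2 statements merged into one kernel-verified Lean document; each statement's English description precedes it below -/
import Mathlib

section
/- Let F = {f_1, …, f_k} (k ≥ 1) be a system of tropical polynomials in n variables over ℝ∞, each of degree at most d (d ≥ 1), and set N = 2(n+2)²·k·(4d)^{min(n,k)+2}. Then F has no root in ℝ∞^n if and only if there exists a nonsingular tropical algebraic combination g of F of degree at most N whose constant coefficient g_0 (the coefficient at the zero exponent vector) is finite. -/
open scoped Classical

/-- Exponent vectors in `n` variables. -/
abbrev Exp (n : ℕ) : Type := Fin n → ℕ

/-- The total degree `|I|` of an exponent vector. -/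
def expDeg {n : ℕ} (I : Exp n) : ℕ := ∑ j, I j

/-- A tropical polynomial: a finite nonempty support of exponent vectors
together with real coefficients. -/
structure TropPoly (n : ℕ) where
  supp : Finset (Exp n)
  supp_nonempty : supp.Nonempty
  coeff : Exp n → ℝ

/-- The degree of a tropical polynomial. -/
def TropPoly.deg {n : ℕ} (f : TropPoly n) : ℕ := f.supp.sup expDeg

/-- Value of the monomial of `f` with exponent `I` at a point of `ℝ^n`. -/
def TropPoly.mono {n : ℕ} (f : TropPoly n) (I : Exp n) (a : Fin n → ℝ) : ℝ :=
  f.coeff I + ∑ j, (I j : ℝ) * a j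

/-- Value of a tropical polynomial at a point of `ℝ^n`. -/
def TropPoly.eval {n : ℕ} (f : TropPoly n) (a : Fin n → ℝ) : ℝ :=
  f.supp.inf' f.supp_nonempty (fun I => f.mono I a)

/-- A point of `ℝ^n` is a root if the minimum is attained at two distinct monomials. -/
def TropPoly.IsRoot {n : ℕ} (f : TropPoly n) (a : Fin n → ℝ) : Prop :=
  ∃ I ∈ f.supp, ∃ J ∈ f.supp, I ≠ J ∧
    f.mono I a = f.eval a ∧ f.mono J a = f.eval a

/-- Value of the monomial of `f` with exponent `I` at a point of `ℝ∞^n`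
(with the convention `0 • ⊤ = 0`). -/
noncomputable def TropPoly.monoT {n : ℕ} (f : TropPoly n) (I : Exp n)
    (a : Fin n → WithTop ℝ) : WithTop ℝ :=
  (f.coeff I : WithTop ℝ) + ∑ j, (I j) • a j

/-- Value of a tropical polynomial at a point of `ℝ∞^n`. -/
noncomputable def TropPoly.evalT {n : ℕ} (f : TropPoly n) (a : Fin n → WithTop ℝ) : WithTop ℝ :=
  f.supp.inf (fun I => f.monoT I a)

/-- A point of `ℝ∞^n` is a root if the minimum is `+∞` or is attained at two
distinct monomials. -/
noncomputable def TropPoly.IsRootT {n : ℕ} (f : TropPoly n) (a : Fin n → WithTop ℝ) : Prop :=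
  f.evalT a = ⊤ ∨ ∃ I ∈ f.supp, ∃ J ∈ f.supp, I ≠ J ∧
    f.monoT I a = f.evalT a ∧ f.monoT J a = f.evalT a

/-- The coefficient of the monomial `x^I` in `x^J ⊙ f`, which is `+∞`
unless `I - J` belongs to the support of `f`. -/
noncomputable def shiftCoeff {n : ℕ} (f : TropPoly n) (J I : Exp n) : WithTop ℝ :=
  if J ≤ I ∧ I - J ∈ f.supp then (f.coeff (I - J) : WithTop ℝ) else ⊤

/-- The entry `c_{f}(I-J) + y_I` of the Macaulay system. -/
noncomputable def macVal {n : ℕ} (f : TropPoly n) (J : Exp n)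
    (y : Exp n → WithTop ℝ) (I : Exp n) : WithTop ℝ :=
  shiftCoeff f J I + y I

/-- The data of a tropical algebraic combination of a system of `k` tropical polynomials
in `n` variables: a finite nonempty list of triples `(c_l, J_l, i_l)`. -/
structure TropComb (n k : ℕ) where
  K : ℕ
  K_pos : 0 < K
  c : Fin K → ℝ
  J : Fin K → Exp n
  idx : Fin K → Fin k

/-- The value `c_l + c_{f_{i_l}}(I - J_l)` contributed by the `l`-th summand at the
exponent vector `I`. -/
noncomputable def TropComb.term {n k : ℕ} (comb : TropComb n k) (F : Fin k → TropPoly n)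
    (l : Fin comb.K) (I : Exp n) : WithTop ℝ :=
  (comb.c l : WithTop ℝ) + shiftCoeff (F (comb.idx l)) (comb.J l) I

/-- The coefficient `g_I = min_l (c_l + c_{f_{i_l}}(I - J_l))` of the combination. -/
noncomputable def TropComb.gCoeff {n k : ℕ} (comb : TropComb n k) (F : Fin k → TropPoly n)
    (I : Exp n) : WithTop ℝ :=
  Finset.univ.inf (fun l : Fin comb.K => comb.term F l I)

/-- The combination has degree at most `N`. -/
def TropComb.DegLE {n k : ℕ} (comb : TropComb n k) (F : Fin k → TropPoly n)
    (N : ℕ) : Prop :=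
  ∀ l : Fin comb.K, expDeg (comb.J l) + (F (comb.idx l)).deg ≤ N

/-- The combination is nonsingular: for every exponent vector `I` with finite coefficient
there is a (necessarily unique) index `l(I)` whose contribution is strictly smaller than
that of every other index, and `l(I) ≠ l(I')` for distinct `I ≠ I'` with finite
coefficients. -/
noncomputable def TropComb.Nonsingular {n k : ℕ} (comb : TropComb n k)
    (F : Fin k → TropPoly n) : Prop :=
  ∃ sel : Exp n → Fin comb.K,
    (∀ I : Exp n, comb.gCoeff F I ≠ ⊤ →
      ∀ l : Fin comb.K, l ≠ sel I → comb.term F (sel I) I < comb.term F l I) ∧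
    (∀ I I' : Exp n, comb.gCoeff F I ≠ ⊤ → comb.gCoeff F I' ≠ ⊤ → I ≠ I' →
      sel I ≠ sel I')

/-! ### Easy direction -/

theorem easy_dir {n k : ℕ} (F : Fin k → TropPoly n) (comb : TropComb n k)
    (hns : comb.Nonsingular F) (h0 : comb.gCoeff F 0 ≠ ⊤)
    (a : Fin n → WithTop ℝ) (ha : ∀ j, (F j).IsRootT a) : False := by
  obtain ⟨sel, hsel, hinj⟩ := hns
  set y : Exp n → WithTop ℝ := fun I => ∑ j, (I j) • a j with hy
  have yadd : ∀ I J : Exp n, y (I + J) = y I + y J := by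
    intro I J
    simp only [hy, Pi.add_apply, add_smul, Finset.sum_add_distrib]
  have gle : ∀ l I, comb.gCoeff F I ≤ comb.term F l I := by
    intro l I
    exact Finset.inf_le (f := fun l => comb.term F l I) (Finset.mem_univ l)
  have gtop : ∀ I, comb.gCoeff F I ≠ ⊤ → comb.term F (sel I) I ≠ ⊤ := by
    intro I hI htop
    apply hI
    unfold TropComb.gCoeff
    rw [Finset.inf_eq_top_iff]
    intro l _
    by_cases hl : l = sel I
    · rw [hl]; exact htop
    · have := hsel I hI l hl
      rw [htop] at this
      exact absurd this (not_lt.mpr le_top)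
  have tfin : ∀ l I, comb.term F l I ≠ ⊤ →
      ∃ I0 ∈ (F (comb.idx l)).supp, I = comb.J l + I0 := by
    intro l I h
    unfold TropComb.term shiftCoeff at h
    split_ifs at h with hc
    · exact ⟨I - comb.J l, hc.2, (add_tsub_cancel_of_le hc.1).symm⟩
    · simp at h
  have tval : ∀ l, ∀ I0 ∈ (F (comb.idx l)).supp,
      comb.term F l (comb.J l + I0) =
        (comb.c l : WithTop ℝ) + ((F (comb.idx l)).coeff I0 : WithTop ℝ) := by
    intro l I0 h
    have h1 : comb.J l + I0 - comb.J l = I0 := add_tsub_cancel_left _ _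
    unfold TropComb.term shiftCoeff
    rw [if_pos ⟨le_self_add, by rw [h1]; exact h⟩, h1]
  let D : Set (Exp n) := {I | comb.gCoeff F I ≠ ⊤ ∧ y I ≠ ⊤}
  have hDfin : D.Finite := by
    apply Set.Finite.subset (s := ⋃ l : Fin comb.K,
      ((fun I0 => comb.J l + I0) '' ((F (comb.idx l)).supp : Set (Exp n))))
    · exact Set.finite_iUnion (fun l => (Finset.finite_toSet _).image _)
    · intro I hI
      obtain ⟨I0, h1, h2⟩ := tfin _ _ (gtop I hI.1)
      exact Set.mem_iUnion.mpr ⟨sel I, I0, h1, h2.symm⟩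
  have hDne : D.Nonempty := ⟨0, h0, by simp [hy]⟩
  obtain ⟨I, hID, hmin⟩ := Set.exists_min_image D
    (fun I => comb.term F (sel I) I + y I) hDfin hDne
  obtain ⟨I0, hI0, hII⟩ := tfin _ _ (gtop I hID.1)
  set l := sel I with hl
  set f := F (comb.idx l) with hf
  have hyI : y (comb.J l) + y I0 ≠ ⊤ := by rw [← yadd, ← hII]; exact hID.2
  have hyJ : y (comb.J l) ≠ ⊤ := (WithTop.add_ne_top.mp hyI).1
  have hyI0 : y I0 ≠ ⊤ := (WithTop.add_ne_top.mp hyI).2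
  have hm0 : f.monoT I0 a ≠ ⊤ := WithTop.add_ne_top.mpr ⟨WithTop.coe_ne_top, hyI0⟩
  have hev : f.evalT a ≤ f.monoT I0 a :=
    Finset.inf_le (f := fun I => f.monoT I a) hI0
  have key : ∃ I1 ∈ f.supp, I1 ≠ I0 ∧ f.monoT I1 a = f.evalT a := by
    rcases ha (comb.idx l) with h | ⟨I1, h1, I2, h2, h12, e1, e2⟩
    · exfalso
      apply hm0
      rw [← hf] at h
      rw [h] at hev
      exact top_le_iff.mp hev
    · by_cases h : I1 = I0
      · exact ⟨I2, h2, fun h' => h12 (h.trans h'.symm), e2⟩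
      · exact ⟨I1, h1, h, e1⟩
  obtain ⟨I1, h1, hne, e1⟩ := key
  have hle : f.monoT I1 a ≤ f.monoT I0 a := e1 ▸ hev
  have hm1 : f.monoT I1 a ≠ ⊤ := fun h => hm0 (top_le_iff.mp (h ▸ hle))
  have hyI1 : y I1 ≠ ⊤ := (WithTop.add_ne_top.mp hm1).2
  have hyQ : y (comb.J l + I1) ≠ ⊤ := by
    rw [yadd]; exact WithTop.add_ne_top.mpr ⟨hyJ, hyI1⟩
  have htQ : comb.term F l (comb.J l + I1) ≠ ⊤ := by
    rw [tval l I1 h1]; exact WithTop.add_ne_top.mpr ⟨WithTop.coe_ne_top, WithTop.coe_ne_top⟩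
  have hgQ : comb.gCoeff F (comb.J l + I1) ≠ ⊤ := by
    intro h
    exact htQ (top_le_iff.mp (h ▸ gle l _))
  have hQI : comb.J l + I1 ≠ I := by
    rw [hII]; intro h; exact hne (add_left_cancel h)
  have hs := hinj _ _ hgQ hID.1 hQI
  have hlt := hsel _ hgQ l (fun h => hs h.symm)
  have h3 := hmin _ ⟨hgQ, hyQ⟩
  have h4 : comb.term F (sel (comb.J l + I1)) (comb.J l + I1) + y (comb.J l + I1)
      < comb.term F l (comb.J l + I1) + y (comb.J l + I1) :=
    WithTop.add_lt_add_right hyQ hlt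
  have h5 : comb.term F l (comb.J l + I1) + y (comb.J l + I1) ≤ comb.term F l I + y I := by
    rw [hII, tval l I1 h1, tval l I0 hI0, yadd, yadd]
    have e : ∀ K, (comb.c l : WithTop ℝ) + (f.coeff K : WithTop ℝ) + (y (comb.J l) + y K)
        = (comb.c l : WithTop ℝ) + y (comb.J l) + f.monoT K a := by
      intro K
      unfold TropPoly.monoT
      simp only [hy]
      abel
    rw [e, e]
    gcongr
  exact absurd (lt_of_lt_of_le h4 h5) (not_lt.mpr h3)

/-! ### Assembling the combination -/

theorem build_comb {n k N : ℕ} (F : Fin k → TropPoly n) (T : Finset (Exp n)) (h0 : 0 ∈ T)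
    (h : Exp n → ℝ) (ix : Exp n → Fin k) (M : Exp n → Exp n)
    (hM : ∀ p ∈ T, M p ∈ (F (ix p)).supp) (hMp : ∀ p ∈ T, M p ≤ p)
    (hN : ∀ p ∈ T, expDeg (p - M p) + (F (ix p)).deg ≤ N)
    (hstep : ∀ p ∈ T, ∀ I ∈ (F (ix p)).supp, I ≠ M p →
      p - M p + I ∈ T ∧
        h (p - M p + I) < h p - (F (ix p)).coeff (M p) + (F (ix p)).coeff I) :
    ∃ comb : TropComb n k, comb.DegLE F N ∧ comb.Nonsingular F ∧ comb.gCoeff F 0 ≠ ⊤ := by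
  let e := T.equivFin
  let P : Fin T.card → Exp n := fun l => (e.symm l).1
  have hP : ∀ l, P l ∈ T := fun l => (e.symm l).2
  let comb : TropComb n k :=
    { K := T.card
      K_pos := Finset.card_pos.mpr ⟨0, h0⟩
      c := fun l => h (P l) - (F (ix (P l))).coeff (M (P l))
      J := fun l => P l - M (P l)
      idx := fun l => ix (P l) }
  have tself : ∀ l : Fin T.card, comb.term F l (P l) = ((h (P l) : ℝ) : WithTop ℝ) := by
    intro l
    have h1 : P l - (P l - M (P l)) = M (P l) := tsub_tsub_cancel_of_le (hMp _ (hP l))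
    change ((h (P l) - (F (ix (P l))).coeff (M (P l)) : ℝ) : WithTop ℝ)
      + shiftCoeff (F (ix (P l))) (P l - M (P l)) (P l) = _
    unfold shiftCoeff
    rw [if_pos ⟨tsub_le_self, by rw [h1]; exact hM _ (hP l)⟩, h1, ← WithTop.coe_add]
    congr 1
    ring
  have tother : ∀ (l : Fin T.card) (q : Exp n), q ≠ P l → comb.term F l q ≠ ⊤ →
      q ∈ T ∧ ((h q : ℝ) : WithTop ℝ) < comb.term F l q := by
    intro l q hq ht
    change ((h (P l) - (F (ix (P l))).coeff (M (P l)) : ℝ) : WithTop ℝ)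
      + shiftCoeff (F (ix (P l))) (P l - M (P l)) q ≠ ⊤ at ht
    change _ ∧ _ < ((h (P l) - (F (ix (P l))).coeff (M (P l)) : ℝ) : WithTop ℝ)
      + shiftCoeff (F (ix (P l))) (P l - M (P l)) q
    unfold shiftCoeff at ht ⊢
    split_ifs at ht ⊢ with hc
    · have hq' : P l - M (P l) + (q - (P l - M (P l))) = q := add_tsub_cancel_of_le hc.1
      have hne : q - (P l - M (P l)) ≠ M (P l) := by
        intro h'
        apply hq
        rw [← hq', h']
        exact tsub_add_cancel_of_le (hMp _ (hP l))
      have := hstep _ (hP l) _ hc.2 hne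
      rw [hq'] at this
      refine ⟨this.1, ?_⟩
      rw [← WithTop.coe_add]
      exact WithTop.coe_lt_coe.mpr this.2
    · simp at ht
  have hPe : ∀ q (hq : q ∈ T), P (e ⟨q, hq⟩) = q := by
    intro q hq; simp [P]
  have gT : ∀ q, comb.gCoeff F q ≠ ⊤ → q ∈ T := by
    intro q hq
    by_contra hqT
    apply hq
    unfold TropComb.gCoeff
    rw [Finset.inf_eq_top_iff]
    intro l _
    by_contra hl
    exact hqT (tother l q (fun h' => hqT (h' ▸ hP l)) hl).1
  refine ⟨comb, ?_, ⟨fun q => if hq : q ∈ T then e ⟨q, hq⟩ else e ⟨0, h0⟩, ?_, ?_⟩, ?_⟩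
  · intro l
    exact hN _ (hP l)
  · intro q hq l hl
    have hqT := gT q hq
    simp only [dif_pos hqT] at hl ⊢
    have h1 := tself (e ⟨q, hqT⟩)
    rw [hPe q hqT] at h1
    have h2 : q ≠ P l := by
      intro h'
      apply hl
      apply e.symm.injective
      rw [Equiv.symm_apply_apply]
      exact Subtype.ext h'.symm
    refine lt_of_eq_of_lt h1 ?_
    by_cases ht : comb.term F l q = ⊤
    · rw [ht]; exact WithTop.coe_lt_top _
    · exact (tother l q h2 ht).2
  · intro q q' hq hq' hne
    simp only [dif_pos (gT q hq), dif_pos (gT q' hq')]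
    intro h'
    exact hne (congrArg Subtype.val (e.injective h'))
  · have h1 := tself (e ⟨0, h0⟩)
    rw [hPe 0 h0] at h1
    intro htop
    have : comb.gCoeff F 0 ≤ comb.term F (e ⟨0, h0⟩) 0 :=
      Finset.inf_le (f := fun l => comb.term F l 0) (Finset.mem_univ _)
    rw [htop, h1] at this
    exact absurd this (not_le.mpr (WithTop.coe_lt_top _))

/-! ### Roots with infinite coordinates from scale gaps -/

/-- The pairing of an exponent vector with a real point. -/
noncomputable def dot {n : ℕ} (p : Exp n) (a : Fin n → ℝ) : ℝ := ∑ j, (p j : ℝ) * a j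

theorem mono_eq {n : ℕ} (f : TropPoly n) (I : Exp n) (a : Fin n → ℝ) :
    f.mono I a = f.coeff I + dot I a := rfl

theorem eval_le {n : ℕ} (f : TropPoly n) {I : Exp n} (hI : I ∈ f.supp) (a : Fin n → ℝ) :
    f.eval a ≤ f.mono I a := Finset.inf'_le (fun I => f.mono I a) hI

theorem exists_eval {n : ℕ} (f : TropPoly n) (a : Fin n → ℝ) :
    ∃ I ∈ f.supp, f.eval a = f.mono I a :=
  Finset.exists_mem_eq_inf' f.supp_nonempty (fun I => f.mono I a)

theorem expDeg_le_deg {n : ℕ} (f : TropPoly n) {I : Exp n} (hI : I ∈ f.supp) :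
    expDeg I ≤ f.deg := Finset.le_sup (f := expDeg) hI

theorem exists_unique_min {n : ℕ} (f : TropPoly n) (a : Fin n → ℝ) (h : ¬ f.IsRoot a) :
    ∃ I ∈ f.supp, f.eval a = f.mono I a ∧
      ∀ I' ∈ f.supp, I' ≠ I → f.mono I a < f.mono I' a := by
  obtain ⟨I, hI, he⟩ := exists_eval f a
  refine ⟨I, hI, he, fun I' hI' hne => ?_⟩
  refine lt_of_le_of_ne (he ▸ eval_le f hI' a) fun h' => h ?_
  exact ⟨I, hI, I', hI', hne.symm, he.symm, by rw [he, h']⟩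

/-- The point with coordinates in `Z` sent to infinity. -/
noncomputable def sendInf {n : ℕ} (Z : Fin n → Prop) (a : Fin n → ℝ) : Fin n → WithTop ℝ :=
  fun j => if Z j then ⊤ else (a j : WithTop ℝ)

theorem monoT_avoid {n : ℕ} (f : TropPoly n) (I : Exp n) (Z : Fin n → Prop) (a : Fin n → ℝ)
    (h : ∀ j, Z j → I j = 0) : f.monoT I (sendInf Z a) = ((f.mono I a : ℝ) : WithTop ℝ) := by
  unfold TropPoly.monoT TropPoly.mono
  rw [WithTop.coe_add, WithTop.coe_sum]
  congr 1
  apply Finset.sum_congr rfl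
  intro j _
  unfold sendInf
  split_ifs with hz
  · simp [h j hz]
  · rw [← nsmul_eq_mul]
    rfl

theorem monoT_hit {n : ℕ} (f : TropPoly n) (I : Exp n) (Z : Fin n → Prop) (a : Fin n → ℝ)
    (h : ∃ j, Z j ∧ I j ≠ 0) : f.monoT I (sendInf Z a) = ⊤ := by
  obtain ⟨j, hz, hj⟩ := h
  unfold TropPoly.monoT
  rw [WithTop.add_eq_top]
  right
  rw [WithTop.sum_eq_top]
  refine ⟨j, Finset.mem_univ _, ?_⟩
  unfold sendInf
  rw [if_pos hz]
  obtain ⟨r, hr⟩ := Nat.exists_eq_succ_of_ne_zero hj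
  rw [hr, succ_nsmul]
  exact WithTop.add_top _

theorem rootT_of {n : ℕ} (f : TropPoly n) (Z : Fin n → Prop) (a : Fin n → ℝ)
    (h : (∀ I ∈ f.supp, ∃ j, Z j ∧ I j ≠ 0) ∨
      (f.IsRoot a ∧ ∀ I ∈ f.supp, f.mono I a = f.eval a → ∀ j, Z j → I j = 0)) :
    f.IsRootT (sendInf Z a) := by
  rcases h with h | ⟨⟨I, hI, J, hJ, hne, e1, e2⟩, h⟩
  · left
    unfold TropPoly.evalT
    rw [Finset.inf_eq_top_iff]
    intro I hI
    exact monoT_hit f I Z a (h I hI)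
  · right
    have hev : f.evalT (sendInf Z a) = ((f.eval a : ℝ) : WithTop ℝ) := by
      apply le_antisymm
      · rw [← e1, ← monoT_avoid f I Z a (h I hI e1)]
        exact Finset.inf_le (f := fun I => f.monoT I (sendInf Z a)) hI
      · apply Finset.le_inf
        intro K hK
        by_cases hh : ∃ j, Z j ∧ K j ≠ 0
        · rw [monoT_hit f K Z a hh]; exact le_top
        · push Not at hh
          rw [monoT_avoid f K Z a hh]
          exact WithTop.coe_le_coe.mpr (eval_le f hK a)
    refine ⟨I, hI, J, hJ, hne, ?_, ?_⟩
    · rw [hev, monoT_avoid f I Z a (h I hI e1), e1]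
    · rw [hev, monoT_avoid f J Z a (h J hJ e2), e2]

theorem gap_lemma (r : ℕ) (v : Fin r → ℝ) (s b : ℝ) (hs : 0 < s) (hb : 1 ≤ b) :
    ∃ l ≤ r, ∀ i, ¬ (s * b ^ l < v i ∧ v i ≤ s * b ^ (l + 1)) := by
  by_contra hcon
  push Not at hcon
  have h1 : ∀ l : Fin (r + 1), ∃ i, s * b ^ (l : ℕ) < v i ∧ v i ≤ s * b ^ ((l : ℕ) + 1) :=
    fun l => hcon l (Nat.lt_succ_iff.mp l.2)
  choose g hg1 hg2 using h1
  obtain ⟨l, l', hne, he⟩ := Fintype.exists_ne_map_eq_of_card_lt g (by simp)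
  have aux : ∀ l l' : Fin (r + 1), l < l' → g l = g l' → False := by
    intro l l' hlt he
    have h3 : s * b ^ ((l : ℕ) + 1) ≤ s * b ^ (l' : ℕ) := by
      have : (l : ℕ) + 1 ≤ l' := hlt
      gcongr
    have := hg2 l
    have := hg1 l'
    rw [he] at *
    linarith
  rcases lt_or_gt_of_ne hne with h | h
  · exact aux l l' h he
  · exact aux l' l h he.symm

theorem dot_le {n : ℕ} (I : Exp n) (a : Fin n → ℝ) (d : ℕ) (hd : expDeg I ≤ d) (s : ℝ)
    (hs : 0 ≤ s) (h : ∀ j, I j ≠ 0 → a j ≤ s) : dot I a ≤ d * s := by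
  have h1 : dot I a ≤ ∑ j, (I j : ℝ) * s := by
    apply Finset.sum_le_sum
    intro j _
    by_cases hj : I j = 0
    · simp [hj]
    · exact mul_le_mul_of_nonneg_left (h j hj) (Nat.cast_nonneg _)
  rw [← Finset.sum_mul] at h1
  have h2 : ((∑ j, (I j : ℝ))) ≤ d := by
    have : ((expDeg I : ℕ) : ℝ) ≤ d := by exact_mod_cast hd
    unfold expDeg at this
    push_cast at this
    exact this
  exact h1.trans (mul_le_mul_of_nonneg_right h2 hs)

theorem le_dot {n : ℕ} (I : Exp n) (a : Fin n → ℝ) (d : ℕ) (hd : expDeg I ≤ d) (B : ℝ)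
    (hB : 0 ≤ B) (h : ∀ j, -B ≤ a j) (j : Fin n) (hj : I j ≠ 0) :
    a j + B - d * B ≤ dot I a := by
  have h1 : dot I a = ∑ j, (I j : ℝ) * (a j + B) - (∑ j, (I j : ℝ)) * B := by
    unfold dot
    rw [Finset.sum_mul, ← Finset.sum_sub_distrib]
    apply Finset.sum_congr rfl
    intro i _
    ring
  have h2 : ((∑ j, (I j : ℝ))) ≤ d := by
    have : ((expDeg I : ℕ) : ℝ) ≤ d := by exact_mod_cast hd
    unfold expDeg at this
    push_cast at this
    exact this
  have h3 : (I j : ℝ) * (a j + B) ≤ ∑ j, (I j : ℝ) * (a j + B) :=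
    Finset.single_le_sum (f := fun j => (I j : ℝ) * (a j + B))
      (fun i _ => mul_nonneg (Nat.cast_nonneg _) (by linarith [h i])) (Finset.mem_univ j)
  have h4 : (1 : ℝ) ≤ I j := by exact_mod_cast Nat.one_le_iff_ne_zero.mpr hj
  have h5 : a j + B ≤ (I j : ℝ) * (a j + B) := by nlinarith [h j]
  nlinarith

/-- Core gap argument: if the coordinates of `a` are bounded below by `-B` and every
polynomial not vanishing at `a` is large there, then the system has a root. -/
theorem root_of_large {n k d : ℕ} (hd : 1 ≤ d) (F : Fin k → TropPoly n)
    (hdeg : ∀ j, (F j).deg ≤ d) (L B : ℝ) (hL0 : 0 < L) (hLB : 2 * L ≤ B)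
    (hL : ∀ i, ∀ I ∈ (F i).supp, |(F i).coeff I| ≤ L)
    (a : Fin n → ℝ) (haB : ∀ j, -B ≤ a j)
    (hV : ∀ i, ¬ (F i).IsRoot a → (4 * d : ℝ) ^ (min n k + 2) * B ≤ (F i).eval a) :
    ∃ a' : Fin n → WithTop ℝ, ∀ j, (F j).IsRootT a' := by
  have hd1 : (1 : ℝ) ≤ d := by exact_mod_cast hd
  have hB0 : 0 < B := by linarith
  have hb1 : (1 : ℝ) ≤ 4 * d := by linarith
  have hdI : ∀ i, ∀ I ∈ (F i).supp, expDeg I ≤ d :=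
    fun i I hI => (expDeg_le_deg _ hI).trans (hdeg i)
  have hc1 : ∀ i, ∀ I ∈ (F i).supp, (F i).coeff I ≤ L :=
    fun i I hI => (abs_le.mp (hL i I hI)).2
  have hc2 : ∀ i, ∀ I ∈ (F i).supp, -L ≤ (F i).coeff I :=
    fun i I hI => (abs_le.mp (hL i I hI)).1
  rcases le_total n k with hnk | hnk
  · rw [min_eq_left hnk] at hV
    obtain ⟨l, hl, hgap⟩ := gap_lemma n a B (4 * d) hB0 hb1
    set s := B * (4 * d : ℝ) ^ l with hs
    have hpl : (1 : ℝ) ≤ (4 * d : ℝ) ^ l := one_le_pow₀ hb1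
    have hsB : B ≤ s := by nlinarith
    have hs1 : B * (4 * d : ℝ) ^ (l + 1) = 4 * d * s := by rw [hs, pow_succ]; ring
    have hmle : (4 * d) * (4 * d) * s ≤ (4 * d : ℝ) ^ (n + 2) * B := by
      have : (4 * d : ℝ) ^ l ≤ (4 * d : ℝ) ^ n := pow_le_pow_right₀ hb1 hl
      rw [hs, pow_add]
      have h2 : (0 : ℝ) ≤ (4 * d) ^ 2 * B := by positivity
      nlinarith
    refine ⟨sendInf (fun j => s < a j) a, fun i => rootT_of _ _ _ ?_⟩
    by_cases hh : ∀ I ∈ (F i).supp, ∃ j, s < a j ∧ I j ≠ 0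
    · exact Or.inl hh
    right
    push Not at hh
    obtain ⟨I, hI, hIz⟩ := hh
    have h1 : dot I a ≤ d * s := dot_le I a d (hdI i I hI) s (by linarith) (by
      intro j hj
      by_contra hcon
      exact hj (hIz j (lt_of_not_ge hcon)))
    have h2 : (F i).eval a ≤ L + d * s := by
      have := eval_le (F i) hI a
      rw [mono_eq] at this
      linarith [hc1 i I hI]
    have hds : s ≤ d * s := by nlinarith
    refine ⟨?_, ?_⟩
    · by_contra hcon
      have h3 := hV i hcon
      have h4 : d * s ≤ d * (d * s) := by nlinarith
      nlinarith
    · intro K hK hKe j hj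
      by_contra hKj
      have h3 := le_dot K a d (hdI i K hK) B hB0.le haB j hKj
      have h4 : 4 * d * s < a j := by
        by_contra hcon
        exact hgap j ⟨hj, by rw [hs1]; exact not_lt.mp hcon⟩
      rw [mono_eq] at hKe
      have h5 := hc2 i K hK
      have h6 : d * B ≤ d * s := by nlinarith
      linarith
  · rw [min_eq_right hnk] at hV
    have hdB : 0 < d * B := by positivity
    obtain ⟨l, hl, hgap⟩ := gap_lemma k (fun i => (F i).eval a) (d * B) (4 * d) hdB hb1
    set s := d * B * (4 * d : ℝ) ^ l with hs
    have hpl : (1 : ℝ) ≤ (4 * d : ℝ) ^ l := one_le_pow₀ hb1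
    have hsB : d * B ≤ s := by nlinarith
    have hBs : B ≤ s := by nlinarith
    have hs1 : d * B * (4 * d : ℝ) ^ (l + 1) = 4 * d * s := by rw [hs, pow_succ]; ring
    have hmle : s < (4 * d : ℝ) ^ (k + 2) * B := by
      have h1 : (4 * d : ℝ) ^ l ≤ (4 * d : ℝ) ^ k := pow_le_pow_right₀ hb1 hl
      have h2 : s ≤ d * B * (4 * d : ℝ) ^ k := by rw [hs]; gcongr
      have h3 : (0 : ℝ) < B * (4 * d : ℝ) ^ k := by positivity
      rw [pow_add]
      nlinarith
    have hds : s ≤ d * s := by nlinarith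
    refine ⟨sendInf (fun j => 2 * s < a j) a, fun i => rootT_of _ _ _ ?_⟩
    by_cases hi : (F i).eval a ≤ s
    · right
      refine ⟨?_, ?_⟩
      · by_contra hcon
        linarith [hV i hcon]
      · intro K hK hKe j hj
        by_contra hKj
        have h3 := le_dot K a d (hdI i K hK) B hB0.le haB j hKj
        rw [mono_eq] at hKe
        have h5 := hc2 i K hK
        linarith
    · left
      intro K hK
      by_contra hcon
      push Not at hcon
      have h1 : dot K a ≤ d * (2 * s) := dot_le K a d (hdI i K hK) _ (by linarith) (by
        intro j hj
        by_contra hc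
        exact hj (hcon j (lt_of_not_ge hc)))
      have h2 : 4 * d * s < (F i).eval a := by
        by_contra hc
        exact hgap i ⟨not_le.mp hi, by rw [hs1]; exact not_lt.mp hc⟩
      have h3 := eval_le (F i) hK a
      rw [mono_eq] at h3
      have := hc1 i K hK
      linarith

theorem exists_good {n k d : ℕ} (hd : 1 ≤ d) (F : Fin k → TropPoly n)
    (hdeg : ∀ j, (F j).deg ≤ d) (L : ℝ) (hL0 : 0 < L)
    (hL : ∀ i, ∀ I ∈ (F i).supp, |(F i).coeff I| ≤ L)
    (hno : ¬ ∃ a : Fin n → WithTop ℝ, ∀ j, (F j).IsRootT a) (m : ℕ)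
    (hm : m = (4 * d) ^ (min n k + 2)) (a : Fin n → ℝ) :
    ∃ i, ¬ (F i).IsRoot a ∧ ((F i).eval a < 2 * L * m ∨
      ∃ j, m * a j + (F i).eval a < 2 * L * m) := by
  by_contra hcon
  push Not at hcon
  have hd1 : (1 : ℝ) ≤ d := by exact_mod_cast hd
  have hmR : (m : ℝ) = (4 * d : ℝ) ^ (min n k + 2) := by rw [hm]; push_cast; rfl
  have hm0 : (0 : ℝ) < m := by rw [hmR]; positivity
  have hVne : ∃ i, ¬ (F i).IsRoot a := by
    by_contra h
    push Not at h
    exact hno ⟨_, fun i => rootT_of (F i) (fun _ => False) a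
      (Or.inr ⟨h i, fun _ _ _ _ hf => hf.elim⟩)⟩
  obtain ⟨i0, hi0⟩ := hVne
  obtain ⟨i, hi, hmin⟩ := Finset.exists_min_image
    (Finset.univ.filter (fun i => ¬ (F i).IsRoot a)) (fun i => (F i).eval a)
    ⟨i0, by simp [hi0]⟩
  simp only [Finset.mem_filter, Finset.mem_univ, true_and] at hi hmin
  obtain ⟨h1, h2⟩ := hcon i hi
  apply hno
  have hC : 0 < 2 * L * m := by positivity
  refine root_of_large hd F hdeg L ((F i).eval a / m) hL0 ?_ hL a ?_ ?_
  · rw [le_div_iff₀ hm0]; exact h1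
  · intro j
    rw [neg_le, ← sub_nonneg]
    have := h2 j
    have e : (F i).eval a / m - -a j = (m * a j + (F i).eval a) / m := by
      field_simp; ring
    rw [e]
    apply div_nonneg _ hm0.le
    linarith
  · intro i' hi'
    rw [← hmR, mul_div_cancel₀ _ hm0.ne']
    exact hmin i' hi'

/-! ### The strictly concave potential -/

open Filter Topology

theorem sqrt_strict (x y s t : ℝ) (hs : 0 < s) (ht : 0 < t) (hst : s + t = 1) (hxy : x ≠ y) :
    Real.sqrt (1 + (s * x + t * y) ^ 2) <
      s * Real.sqrt (1 + x ^ 2) + t * Real.sqrt (1 + y ^ 2) := by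
  have hX := Real.sqrt_nonneg (1 + x ^ 2)
  have hY := Real.sqrt_nonneg (1 + y ^ 2)
  have hX2 := Real.sq_sqrt (show (0 : ℝ) ≤ 1 + x ^ 2 by positivity)
  have hY2 := Real.sq_sqrt (show (0 : ℝ) ≤ 1 + y ^ 2 by positivity)
  set X := Real.sqrt (1 + x ^ 2)
  set Y := Real.sqrt (1 + y ^ 2)
  have hXY : 1 + x * y < X * Y := by
    apply lt_of_pow_lt_pow_left₀ 2 (by positivity)
    have : 0 < (x - y) ^ 2 := by
      have : x - y ≠ 0 := sub_ne_zero.mpr hxy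
      positivity
    rw [mul_pow, hX2, hY2]
    nlinarith
  rw [Real.sqrt_lt' (by
    have : 0 < X := Real.sqrt_pos.mpr (by positivity)
    positivity)]
  have e : 1 + (s * x + t * y) ^ 2 = s ^ 2 * X ^ 2 + t ^ 2 * Y ^ 2 + 2 * (s * t) * (1 + x * y) := by
    rw [hX2, hY2]
    have : t = 1 - s := by linarith
    subst this
    ring
  rw [e]
  have : 0 < s * t := by positivity
  nlinarith

/-- The strictly concave regularizer. -/
noncomputable def regG {n : ℕ} (a : Fin n → ℝ) : ℝ :=
  - ((1 / 2) * ∑ j, Real.sqrt (1 + (a j) ^ 2))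

theorem regG_strict {n : ℕ} (a b : Fin n → ℝ) (hab : a ≠ b) (s t : ℝ) (hs : 0 < s) (ht : 0 < t)
    (hst : s + t = 1) : s * regG a + t * regG b < regG (s • a + t • b) := by
  unfold regG
  have : ∑ j, Real.sqrt (1 + ((s • a + t • b) j) ^ 2) <
      ∑ j, (s * Real.sqrt (1 + a j ^ 2) + t * Real.sqrt (1 + b j ^ 2)) := by
    apply Finset.sum_lt_sum
    · intro j _
      by_cases h : a j = b j
      · have e : (s • a + t • b) j = b j := by
          simp only [Pi.add_apply, Pi.smul_apply, smul_eq_mul, h]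
          rw [← add_mul, hst, one_mul]
        rw [e, h, ← add_mul, hst, one_mul]
      · exact (sqrt_strict _ _ s t hs ht hst h).le
    · obtain ⟨j, hj⟩ := Function.ne_iff.mp hab
      exact ⟨j, Finset.mem_univ _, sqrt_strict _ _ s t hs ht hst hj⟩
  rw [Finset.sum_add_distrib, ← Finset.mul_sum, ← Finset.mul_sum] at this
  linarith

theorem regG_cont {n : ℕ} : Continuous (regG (n := n)) := by
  unfold regG
  fun_prop

theorem sqrt_lip (x y : ℝ) (h : |y - x| ≤ 1) :
    Real.sqrt (1 + y ^ 2) ≤ Real.sqrt (1 + x ^ 2) + 1 := by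
  have hX := Real.sqrt_nonneg (1 + x ^ 2)
  have hX2 := Real.sq_sqrt (show (0 : ℝ) ≤ 1 + x ^ 2 by positivity)
  have hx : |x| ≤ Real.sqrt (1 + x ^ 2) := Real.abs_le_sqrt (by linarith)
  rw [Real.sqrt_le_left (by linarith)]
  have h1 := abs_le.mp h
  have h2 := abs_le.mp hx
  nlinarith

theorem regG_single {n : ℕ} (a : Fin n → ℝ) (j : Fin n) :
    regG a - 1 / 2 ≤ regG (a + Pi.single j 1) := by
  unfold regG
  have : ∑ i, Real.sqrt (1 + ((a + Pi.single j (1 : ℝ) : Fin n → ℝ) i) ^ 2) ≤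
      ∑ i, (Real.sqrt (1 + a i ^ 2) + if i = j then 1 else 0) := by
    apply Finset.sum_le_sum
    intro i _
    by_cases h : i = j
    · subst h
      simp only [Pi.add_apply, Pi.single_eq_same, if_true]
      exact sqrt_lip _ _ (by simp)
    · simp [h]
  rw [Finset.sum_add_distrib, Finset.sum_ite_eq' Finset.univ j] at this
  simp only [Finset.mem_univ, if_true] at this
  linarith

theorem regG_down {n : ℕ} (a : Fin n → ℝ) :
    regG a - n ≤ regG (fun j => a j - 1) := by
  unfold regG
  have : ∑ i, Real.sqrt (1 + (a i - 1) ^ 2) ≤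
      ∑ i : Fin n, (Real.sqrt (1 + a i ^ 2) + 1) := by
    apply Finset.sum_le_sum
    intro i _
    exact sqrt_lip _ _ (by simp)
  rw [Finset.sum_add_distrib] at this
  simp at this
  have h0 : (0 : ℝ) ≤ n := Nat.cast_nonneg n
  simp only [one_div]
  linarith

theorem regG_coercive {n : ℕ} (a : Fin n → ℝ) : regG a ≤ - ((1 / 2) * ‖a‖) := by
  unfold regG
  have : ‖a‖ ≤ ∑ j, Real.sqrt (1 + (a j) ^ 2) := by
    rw [pi_norm_le_iff_of_nonneg (Finset.sum_nonneg fun _ _ => Real.sqrt_nonneg _)]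
    intro j
    have h1 : ‖a j‖ ≤ Real.sqrt (1 + a j ^ 2) := Real.abs_le_sqrt (by linarith)
    exact h1.trans (Finset.single_le_sum (f := fun j => Real.sqrt (1 + (a j) ^ 2))
      (fun _ _ => Real.sqrt_nonneg _) (Finset.mem_univ j))
  linarith

theorem dot_comb {n : ℕ} (p : Exp n) (a b : Fin n → ℝ) (s t : ℝ) :
    dot p (s • a + t • b) = s * dot p a + t * dot p b := by
  unfold dot
  rw [Finset.mul_sum, Finset.mul_sum, ← Finset.sum_add_distrib]
  apply Finset.sum_congr rfl
  intro j _
  simp only [Pi.add_apply, Pi.smul_apply, smul_eq_mul]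
  ring

theorem dot_cont {n : ℕ} (p : Exp n) : Continuous (dot p) := by
  unfold dot
  fun_prop

theorem dot_add {n : ℕ} (p q : Exp n) (a : Fin n → ℝ) : dot (p + q) a = dot p a + dot q a := by
  unfold dot
  rw [← Finset.sum_add_distrib]
  apply Finset.sum_congr rfl
  intro j _
  simp only [Pi.add_apply, Nat.cast_add]
  ring

theorem dot_single {n : ℕ} (p : Exp n) (a : Fin n → ℝ) (j : Fin n) :
    dot p (a + Pi.single j 1) = dot p a + p j := by
  unfold dot
  simp only [Pi.add_apply, mul_add, Finset.sum_add_distrib]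
  congr 1
  rw [Finset.sum_eq_single j]
  · simp
  · intro i _ hi
    simp [hi]
  · simp

theorem dot_down {n : ℕ} (p : Exp n) (a : Fin n → ℝ) :
    dot p (fun j => a j - 1) = dot p a - expDeg p := by
  unfold dot expDeg
  simp only [mul_sub, Finset.sum_sub_distrib, mul_one]
  push_cast
  rfl

/-- A concave function with a strict maximum decays linearly. -/
theorem decay {n : ℕ} (psi : (Fin n → ℝ) → ℝ) (hc : Continuous psi) (a : Fin n → ℝ)
    (hconc : ∀ b, ∀ s t : ℝ, 0 < s → 0 < t → s + t = 1 →
      s * psi a + t * psi b ≤ psi (s • a + t • b))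
    (hmax : ∀ b, b ≠ a → psi b < psi a) :
    ∃ e > 0, ∀ b, 1 < ‖b - a‖ → psi b ≤ psi a - e * ‖b - a‖ := by
  rcases (Metric.sphere a 1).eq_empty_or_nonempty with hemp | hne
  · refine ⟨1, one_pos, fun b hb => ?_⟩
    exfalso
    have h0 : ‖b - a‖ ≠ 0 := by linarith
    have : a + ‖b - a‖⁻¹ • (b - a) ∈ Metric.sphere a 1 := by
      rw [mem_sphere_iff_norm, add_sub_cancel_left, norm_smul, norm_inv, norm_norm,
        inv_mul_cancel₀ h0]
    rw [hemp] at this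
    exact this
  · obtain ⟨z, hz, hzmax⟩ := (isCompact_sphere a 1).exists_isMaxOn hne hc.continuousOn
    have hza : z ≠ a := by
      rintro rfl
      simp at hz
    refine ⟨psi a - psi z, sub_pos.mpr (hmax z hza), fun b hb => ?_⟩
    set r := ‖b - a‖ with hr
    have hr0 : 0 < r := by linarith
    have hmem : (1 - r⁻¹) • a + r⁻¹ • b ∈ Metric.sphere a 1 := by
      rw [mem_sphere_iff_norm]
      have e : (1 - r⁻¹) • a + r⁻¹ • b - a = r⁻¹ • (b - a) := by
        ext j
        simp only [Pi.sub_apply, Pi.add_apply, Pi.smul_apply, smul_eq_mul]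
        ring
      rw [e, norm_smul, norm_inv, ← hr, Real.norm_of_nonneg hr0.le, inv_mul_cancel₀ hr0.ne']
    have h1 := hzmax hmem
    simp only [Set.mem_ofPred_eq] at h1
    have hri : r⁻¹ < 1 := inv_lt_one_of_one_lt₀ hb
    have h2 := hconc b (1 - r⁻¹) r⁻¹ (by linarith) (inv_pos.mpr hr0) (by ring)
    have h3 := h2.trans h1
    have h4 : r * ((1 - r⁻¹) * psi a + r⁻¹ * psi b) ≤ r * psi z :=
      mul_le_mul_of_nonneg_left h3 hr0.le
    have h5 : r * ((1 - r⁻¹) * psi a + r⁻¹ * psi b) = (r - 1) * psi a + psi b := by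
      field_simp
    nlinarith

theorem exists_max_of_le {n : ℕ} (th : (Fin n → ℝ) → ℝ) (hc : Continuous th) (a : Fin n → ℝ)
    (M e : ℝ) (he : 0 < e) (h : ∀ b, 1 < ‖b - a‖ → th b ≤ M - e * ‖b - a‖) :
    ∃ z, ∀ b, th b ≤ th z := by
  apply hc.exists_forall_ge' a
  have h1 : Tendsto (fun b : Fin n → ℝ => ‖b - a‖) (cocompact _) atTop := by
    have := tendsto_dist_right_cocompact_atTop a
    simpa [dist_eq_norm] using this
  filter_upwards [h1.eventually_gt_atTop 1, h1.eventually_ge_atTop ((M - th a) / e)] with b h2 h3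
  have h4 := h b h2
  rw [div_le_iff₀ he] at h3
  linarith

section potential

variable {n : ℕ} {ι : Type} [Fintype ι] [DecidableEq ι]

/-- The potential. -/
noncomputable def potH (S : ι → (Fin n → ℝ) → ℝ) (a : Fin n → ℝ) : ℝ :=
  ∑ x, S x a + regG a

/-- The potential with one summand replaced by the exponent `X`, tilted by `p`. -/
noncomputable def potPsi (S : ι → (Fin n → ℝ) → ℝ) (x : ι) (p X : Exp n)
    (a : Fin n → ℝ) : ℝ :=
  ∑ y ∈ Finset.univ.erase x, S y a + regG a - dot p a + dot X a

theorem potPsi_eq (S : ι → (Fin n → ℝ) → ℝ) (x : ι) (p X : Exp n) (a : Fin n → ℝ) :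
    potH S a - dot p a = potPsi S x p X a + (S x a - dot X a) := by
  unfold potH potPsi
  rw [← Finset.add_sum_erase _ _ (Finset.mem_univ x)]
  ring

/-- `a` maximizes the tilted potential. -/
def IsMaxAt (S : ι → (Fin n → ℝ) → ℝ) (p : Exp n) (a : Fin n → ℝ) : Prop :=
  ∀ b, potH S b - dot p b ≤ potH S a - dot p a

/-- The standing hypotheses on the summands. -/
structure Good (S : ι → (Fin n → ℝ) → ℝ) (C : ℝ) (D : ℕ) : Prop where
  cont : ∀ x, Continuous (S x)
  conc : ∀ x a b, ∀ s t : ℝ, 0 < s → 0 < t → s + t = 1 →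
    s * S x a + t * S x b ≤ S x (s • a + t • b)
  up : ∀ x a j, S x a ≤ S x (a + Pi.single j 1)
  down : ∀ x a, S x a - D ≤ S x (fun j => a j - 1)
  bdd : ∀ x a, S x a ≤ C

theorem potH_cont {S : ι → (Fin n → ℝ) → ℝ} {C : ℝ} {D : ℕ} (hS : Good S C D) :
    Continuous (potH S) := by
  unfold potH
  exact (continuous_finsetSum _ fun x _ => hS.cont x).add regG_cont

theorem potPsi_cont {S : ι → (Fin n → ℝ) → ℝ} {C : ℝ} {D : ℕ} (hS : Good S C D) (x : ι)
    (p X : Exp n) : Continuous (potPsi S x p X) := by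
  unfold potPsi
  exact (((continuous_finsetSum _ fun x _ => hS.cont x).add regG_cont).sub
    (dot_cont p)).add (dot_cont X)

theorem potPsi_strict {S : ι → (Fin n → ℝ) → ℝ} {C : ℝ} {D : ℕ} (hS : Good S C D) (x : ι)
    (p X : Exp n) (a b : Fin n → ℝ) (hab : a ≠ b) (s t : ℝ) (hs : 0 < s) (ht : 0 < t)
    (hst : s + t = 1) :
    s * potPsi S x p X a + t * potPsi S x p X b < potPsi S x p X (s • a + t • b) := by
  unfold potPsi
  have h1 := regG_strict a b hab s t hs ht hst
  have h2 : s * ∑ y ∈ Finset.univ.erase x, S y a + t * ∑ y ∈ Finset.univ.erase x, S y b ≤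
      ∑ y ∈ Finset.univ.erase x, S y (s • a + t • b) := by
    rw [Finset.mul_sum, Finset.mul_sum, ← Finset.sum_add_distrib]
    exact Finset.sum_le_sum fun y _ => hS.conc y a b s t hs ht hst
  rw [dot_comb, dot_comb]
  linarith

theorem pot_zero_max {S : ι → (Fin n → ℝ) → ℝ} {C : ℝ} {D : ℕ} (hS : Good S C D) :
    ∃ a, IsMaxAt S 0 a := by
  have h0 : ∀ b : Fin n → ℝ, dot (0 : Exp n) b = 0 := by intro b; simp [dot]
  obtain ⟨z, hz⟩ := exists_max_of_le (potH S) (potH_cont hS) 0 (∑ _x : ι, C) (1 / 2)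
    (by norm_num) (by
      intro b _
      rw [sub_zero]
      unfold potH
      have h1 : ∑ x, S x b ≤ ∑ _x : ι, C := Finset.sum_le_sum fun x _ => hS.bdd x b
      have h2 := regG_coercive b
      linarith)
  exact ⟨z, fun b => by rw [h0, h0]; linarith [hz b]⟩

theorem psi_max {S : ι → (Fin n → ℝ) → ℝ} {C : ℝ} {D : ℕ} (hS : Good S C D) (x : ι)
    (p X : Exp n) (c : ℝ) (a : Fin n → ℝ) (hmax : IsMaxAt S p a)
    (hloc : ∀ᶠ b in 𝓝 a, S x b = c + dot X b) (b : Fin n → ℝ) (hb : b ≠ a) :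
    potPsi S x p X b < potPsi S x p X a := by
  by_contra hcon
  have hcon := not_lt.mp hcon
  have hline : Tendsto (fun t : ℝ => (1 - t) • a + t • b) (𝓝[>] 0) (𝓝 a) := by
    have : Continuous (fun t : ℝ => (1 - t) • a + t • b) := by fun_prop
    have h := this.tendsto 0
    simp only [sub_zero, one_smul, zero_smul, add_zero] at h
    exact h.mono_left nhdsWithin_le_nhds
  have h1 := hline.eventually hloc
  have h2 : ∀ᶠ t : ℝ in 𝓝[>] 0, t ∈ Set.Ioo (0 : ℝ) 1 := Ioo_mem_nhdsGT one_pos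
  obtain ⟨t, ht1, ht2⟩ := (h1.and h2).exists
  have h3 := potPsi_strict hS x p X a b hb.symm (1 - t) t (by linarith [ht2.2]) ht2.1 (by ring)
  have h4 := hmax ((1 - t) • a + t • b)
  rw [potPsi_eq S x p X, potPsi_eq S x p X, ht1, hloc.self_of_nhds] at h4
  have := ht2.1
  nlinarith

theorem step {S : ι → (Fin n → ℝ) → ℝ} {C : ℝ} {D : ℕ} (hS : Good S C D) (x : ι)
    (p X : Exp n) (c : ℝ) (a : Fin n → ℝ) (hmax : IsMaxAt S p a)
    (hloc : ∀ᶠ b in 𝓝 a, S x b = c + dot X b) :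
    X ≤ p ∧ expDeg p + D ≤ expDeg X + Fintype.card ι * D + n ∧
    ∀ (X' q : Exp n) (c' : ℝ), q + X = p + X' → (∀ b, S x b ≤ c' + dot X' b) →
      S x a < c' + dot X' a →
      (∃ b, IsMaxAt S q b) ∧ ∀ b, IsMaxAt S q b →
        potH S b - dot q b < potH S a - dot p a - c + c' := by
  have hpsi := psi_max hS x p X c a hmax hloc
  have hle : ∀ b, potPsi S x p X b ≤ potPsi S x p X a := by
    intro b
    by_cases h : b = a
    · rw [h]
    · exact (hpsi b h).le
  have hval : potH S a - dot p a - c = potPsi S x p X a := by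
    rw [potPsi_eq S x p X, hloc.self_of_nhds]; ring
  refine ⟨?_, ?_, ?_⟩
  · intro j
    have h1 := hle (a + Pi.single j 1)
    unfold potPsi at h1
    rw [dot_single, dot_single] at h1
    have h2 := regG_single a j
    have h3 : ∑ y ∈ Finset.univ.erase x, S y a ≤
        ∑ y ∈ Finset.univ.erase x, S y (a + Pi.single j 1) :=
      Finset.sum_le_sum fun y _ => hS.up y a j
    have h4 : (X j : ℝ) < p j + 1 := by linarith
    have h5 : X j < p j + 1 := by exact_mod_cast h4
    exact Nat.lt_succ_iff.mp h5
  · have h1 := hle (fun j => a j - 1)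
    unfold potPsi at h1
    rw [dot_down, dot_down] at h1
    have h2 := regG_down a
    have h3 : ∑ y ∈ Finset.univ.erase x, (S y a - D) ≤
        ∑ y ∈ Finset.univ.erase x, S y (fun j => a j - 1) :=
      Finset.sum_le_sum fun y _ => hS.down y a
    rw [Finset.sum_sub_distrib] at h3
    have h6 : ∑ y ∈ Finset.univ.erase x, (D : ℝ) + D = Fintype.card ι * D := by
      rw [Finset.sum_erase_add _ _ (Finset.mem_univ x)]
      simp
    have h7 : (expDeg p : ℝ) + D ≤ expDeg X + Fintype.card ι * D + n := by linarith
    exact_mod_cast h7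
  · intro X' q c' hq hSle hSlt
    have hdq : ∀ b, dot q b = dot p b + dot X' b - dot X b := by
      intro b
      have : dot (q + X) b = dot (p + X') b := by rw [hq]
      rw [dot_add, dot_add] at this
      linarith
    have hth : ∀ b, potH S b - dot q b = potPsi S x p X b + (S x b - dot X' b) := by
      intro b
      rw [hdq]
      linarith [potPsi_eq S x p X b]
    refine ⟨?_, ?_⟩
    · obtain ⟨e, he, hdec⟩ := decay (potPsi S x p X) (potPsi_cont hS x p X) a (by
        intro b s t hs ht hst
        by_cases h : a = b
        · rw [← h, ← add_mul, ← add_smul, hst, one_mul, one_smul]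
        · exact (potPsi_strict hS x p X a b h s t hs ht hst).le) hpsi
      exact exists_max_of_le (fun b => potH S b - dot q b)
        ((potH_cont hS).sub (dot_cont q)) a (potPsi S x p X a + c') e he (by
          intro b hb
          have h1 := hdec b hb
          have h2 := hSle b
          have h3 := hth b
          linarith)
    · intro b _
      rw [hval, hth]
      by_cases h : b = a
      · rw [h]; linarith
      · linarith [hpsi b h, hSle b]

end potential

/-! ### The summands coming from the system -/

theorem eval_cont {n : ℕ} (f : TropPoly n) : Continuous f.eval := by
  unfold TropPoly.eval
  apply Continuous.finset_inf'_apply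
  intro I _
  exact continuous_const.add (dot_cont I)

theorem le_eval {n : ℕ} (f : TropPoly n) (a : Fin n → ℝ) (r : ℝ)
    (h : ∀ I ∈ f.supp, r ≤ f.mono I a) : r ≤ f.eval a :=
  Finset.le_inf' f.supp_nonempty _ h

/-- The shift exponents. -/
def shiftJ {n : ℕ} (m : ℕ) : Option (Fin n) → Exp n
  | none => 0
  | some j => Pi.single j m

theorem expDeg_add {n : ℕ} (p q : Exp n) : expDeg (p + q) = expDeg p + expDeg q := by
  unfold expDeg
  simp [Finset.sum_add_distrib]

theorem expDeg_shiftJ {n : ℕ} (m : ℕ) (o : Option (Fin n)) : expDeg (shiftJ m o) ≤ m := by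
  cases o with
  | none => simp [shiftJ, expDeg]
  | some j => simp [shiftJ, expDeg]

theorem dot_shiftJ_some {n : ℕ} (m : ℕ) (j : Fin n) (a : Fin n → ℝ) :
    dot (shiftJ m (some j)) a = m * a j := by
  unfold dot shiftJ
  rw [Finset.sum_eq_single j]
  · simp
  · intro i _ hi
    simp [hi]
  · simp

/-- The summand functions. -/
noncomputable def sumS {n k : ℕ} (F : Fin k → TropPoly n) (m : ℕ) (C : ℝ)
    (x : Fin k × Option (Fin n)) (a : Fin n → ℝ) : ℝ :=
  min C (dot (shiftJ m x.2) a + (F x.1).eval a)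

theorem sumS_le {n k : ℕ} (F : Fin k → TropPoly n) (m : ℕ) (C : ℝ)
    (x : Fin k × Option (Fin n)) (a : Fin n → ℝ) {I : Exp n} (hI : I ∈ (F x.1).supp) :
    sumS F m C x a ≤ (F x.1).coeff I + dot (shiftJ m x.2 + I) a := by
  have h := eval_le (F x.1) hI a
  rw [mono_eq] at h
  rw [dot_add]
  exact (min_le_right _ _).trans (by linarith)

theorem le_sumS {n k : ℕ} (F : Fin k → TropPoly n) (m : ℕ) (C : ℝ)
    (x : Fin k × Option (Fin n)) (a : Fin n → ℝ) (r : ℝ) (hC : r ≤ C)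
    (h : ∀ I ∈ (F x.1).supp, r ≤ (F x.1).coeff I + dot (shiftJ m x.2 + I) a) :
    r ≤ sumS F m C x a := by
  refine le_min hC ?_
  have : r - dot (shiftJ m x.2) a ≤ (F x.1).eval a := by
    apply le_eval
    intro I hI
    have := h I hI
    rw [dot_add] at this
    rw [mono_eq]
    linarith
  linarith

theorem sumS_good {n k d : ℕ} (F : Fin k → TropPoly n) (hdeg : ∀ j, (F j).deg ≤ d)
    (m : ℕ) (C : ℝ) : Good (sumS F m C) C (m + d) where
  cont x := continuous_const.min ((dot_cont _).add (eval_cont _))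
  conc x a b s t hs ht hst := by
    have hCa : sumS F m C x a ≤ C := min_le_left _ _
    have hCb : sumS F m C x b ≤ C := min_le_left _ _
    have hst' : t = 1 - s := by linarith
    apply le_sumS
    · subst hst'; nlinarith
    · intro I hI
      have h1 := sumS_le F m C x a hI
      have h2 := sumS_le F m C x b hI
      rw [dot_comb]
      have h3 := mul_le_mul_of_nonneg_left h1 hs.le
      have h4 := mul_le_mul_of_nonneg_left h2 ht.le
      subst hst'
      nlinarith
  up x a j := by
    have hCa : sumS F m C x a ≤ C := min_le_left _ _
    apply le_sumS _ _ _ _ _ _ hCa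
    intro I hI
    have h1 := sumS_le F m C x a hI
    rw [dot_single]
    have : (0 : ℝ) ≤ ((shiftJ m x.2 + I) j : ℕ) := Nat.cast_nonneg _
    linarith
  down x a := by
    have hCa : sumS F m C x a ≤ C := min_le_left _ _
    have h0 : (0 : ℝ) ≤ ((m + d : ℕ) : ℝ) := Nat.cast_nonneg _
    apply le_sumS
    · linarith
    · intro I hI
      have h1 := sumS_le F m C x a hI
      rw [dot_down]
      have h2 : expDeg (shiftJ m x.2 + I) ≤ m + d := by
        rw [expDeg_add]
        exact add_le_add (expDeg_shiftJ m x.2) ((expDeg_le_deg _ hI).trans (hdeg _))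
      have h3 : (expDeg (shiftJ m x.2 + I) : ℝ) ≤ ((m + d : ℕ) : ℝ) := by exact_mod_cast h2
      linarith
  bdd x a := min_le_left _ _

theorem sumS_local {n k : ℕ} (F : Fin k → TropPoly n) (m : ℕ) (C : ℝ)
    (x : Fin k × Option (Fin n)) (a : Fin n → ℝ) (I : Exp n) (hI : I ∈ (F x.1).supp)
    (hu : ∀ I' ∈ (F x.1).supp, I' ≠ I → (F x.1).mono I a < (F x.1).mono I' a)
    (hlt : dot (shiftJ m x.2) a + (F x.1).mono I a < C) :
    ∀ᶠ b in 𝓝 a, sumS F m C x b = (F x.1).coeff I + dot (shiftJ m x.2 + I) b := by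
  have hmc : ∀ I', Continuous ((F x.1).mono I') := fun I' => continuous_const.add (dot_cont I')
  have h1 : ∀ᶠ b in 𝓝 a, dot (shiftJ m x.2) b + (F x.1).mono I b < C :=
    (((dot_cont _).add (hmc I)).tendsto a).eventually_lt_const hlt
  have h2 : ∀ᶠ b in 𝓝 a, ∀ I' ∈ (F x.1).supp, (F x.1).mono I b ≤ (F x.1).mono I' b := by
    rw [Filter.eventually_all_finset]
    intro I' hI'
    by_cases h : I' = I
    · rw [h]; exact Filter.Eventually.of_forall fun _ => le_rfl
    · filter_upwards [((hmc I).tendsto a).eventually_lt ((hmc I').tendsto a) (hu I' hI' h)]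
        with b hb
      exact hb.le
  filter_upwards [h1, h2] with b hb1 hb2
  apply le_antisymm (sumS_le F m C x b hI)
  apply le_sumS
  · rw [dot_add]; rw [mono_eq] at hb1; linarith
  · intro I' hI'
    have := hb2 I' hI'
    rw [mono_eq, mono_eq] at this
    rw [dot_add, dot_add]
    linarith

theorem hard_dir (n k d : ℕ) (hk : 1 ≤ k) (hd : 1 ≤ d)
    (F : Fin k → TropPoly n) (hdeg : ∀ j : Fin k, (F j).deg ≤ d)
    (hno : ¬ ∃ a : Fin n → WithTop ℝ, ∀ j : Fin k, (F j).IsRootT a) :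
    ∃ comb : TropComb n k,
      comb.DegLE F (2 * (n + 2) ^ 2 * k * (4 * d) ^ (min n k + 2)) ∧
      comb.Nonsingular F ∧ comb.gCoeff F 0 ≠ ⊤ := by
  obtain ⟨m, hm⟩ : ∃ m : ℕ, m = (4 * d) ^ (min n k + 2) := ⟨_, rfl⟩
  rw [← hm]
  have hdm : d ≤ m := by
    rw [hm]
    calc d ≤ 4 * d := by omega
      _ ≤ (4 * d) ^ (min n k + 2) := Nat.le_self_pow (by omega) _
  -- a bound for the coefficients
  obtain ⟨L, hL0, hL⟩ : ∃ L : ℝ, 0 < L ∧ ∀ i, ∀ I ∈ (F i).supp, |(F i).coeff I| ≤ L := by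
    refine ⟨1 + ∑ i, ∑ I ∈ (F i).supp, |(F i).coeff I|, ?_, ?_⟩
    · have : 0 ≤ ∑ i, ∑ I ∈ (F i).supp, |(F i).coeff I| :=
        Finset.sum_nonneg fun _ _ => Finset.sum_nonneg fun _ _ => abs_nonneg _
      linarith
    · intro i I hI
      have h1 : |(F i).coeff I| ≤ ∑ I ∈ (F i).supp, |(F i).coeff I| :=
        Finset.single_le_sum (f := fun I => |(F i).coeff I|) (fun _ _ => abs_nonneg _) hI
      have h2 : ∑ I ∈ (F i).supp, |(F i).coeff I| ≤ ∑ i, ∑ I ∈ (F i).supp, |(F i).coeff I| :=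
        Finset.single_le_sum (f := fun i => ∑ I ∈ (F i).supp, |(F i).coeff I|)
          (fun _ _ => Finset.sum_nonneg fun _ _ => abs_nonneg _) (Finset.mem_univ i)
      linarith
  set C : ℝ := 2 * L * m with hC
  have hS := sumS_good F hdeg m C
  set S := sumS F m C with hSdef
  -- at each point a good summand exists
  have hgood : ∀ a : Fin n → ℝ, ∃ x : Fin k × Option (Fin n), ∃ I ∈ (F x.1).supp,
      (∀ I' ∈ (F x.1).supp, I' ≠ I → (F x.1).mono I a < (F x.1).mono I' a) ∧
      dot (shiftJ m x.2) a + (F x.1).mono I a < C := by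
    intro a
    obtain ⟨i, hi, h⟩ := exists_good hd F hdeg L hL0 hL hno m hm a
    obtain ⟨I, hI, he, hu⟩ := exists_unique_min (F i) a hi
    rcases h with h | ⟨j, h⟩
    · refine ⟨(i, none), I, hI, hu, ?_⟩
      have h0 : dot (shiftJ m (none : Option (Fin n))) a = 0 := by simp [dot, shiftJ]
      simp only [h0]
      rw [← he]
      linarith
    · refine ⟨(i, some j), I, hI, hu, ?_⟩
      simp only [dot_shiftJ_some]
      rw [← he]
      linarith
  choose xx II hII hu hlt using hgood
  let E : Set (Exp n) := {p | ∃ a, IsMaxAt S p a}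
  let pt : Exp n → (Fin n → ℝ) := fun p => if h : ∃ a, IsMaxAt S p a then h.choose else 0
  have hpt : ∀ p ∈ E, IsMaxAt S p (pt p) := by
    intro p hp
    have hp' : ∃ a, IsMaxAt S p a := hp
    simp only [pt, dif_pos hp']
    exact hp'.choose_spec
  have hst := fun p (hp : p ∈ E) => step hS (xx (pt p)) p
    (shiftJ m (xx (pt p)).2 + II (pt p)) ((F (xx (pt p)).1).coeff (II (pt p))) (pt p) (hpt p hp)
    (sumS_local F m C (xx (pt p)) (pt p) (II (pt p)) (hII _) (hu _) (hlt _))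
  have hcard : Fintype.card (Fin k × Option (Fin n)) = k * (n + 1) := by simp
  have hM : ∀ p ∈ E, II (pt p) ≤ p := fun p hp => le_trans le_add_self (hst p hp).1
  have hIIdeg : ∀ a, expDeg (II a) ≤ d := fun a => (expDeg_le_deg _ (hII a)).trans (hdeg _)
  have hNN : k * (n + 1) * (m + d) + n ≤ 2 * (n + 2) ^ 2 * k * m := by
    have h1 : k * (n + 1) * (m + d) ≤ k * (n + 1) * (2 * m) :=
      Nat.mul_le_mul_left _ (by omega)
    have h2 : n ≤ n * (k * m) := Nat.le_mul_of_pos_right _ (Nat.mul_pos hk (by omega))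
    nlinarith [Nat.zero_le (k * m), Nat.zero_le (n * (k * m)), Nat.zero_le (n * n * (k * m))]
  have hdegp : ∀ p ∈ E, expDeg p ≤ expDeg (II (pt p)) + (k * (n + 1) * (m + d) + n) - d := by
    intro p hp
    have h1 := (hst p hp).2.1
    rw [hcard, expDeg_add] at h1
    have h2 := expDeg_shiftJ m (xx (pt p)).2
    omega
  have hEfin : E.Finite := by
    apply (Set.finite_Iic (fun _ : Fin n => d + (k * (n + 1) * (m + d) + n))).subset
    intro p hp j
    have h1 := hdegp p hp
    have h2 := hIIdeg (pt p)
    have h3 : p j ≤ expDeg p := Finset.single_le_sum (f := p) (fun _ _ => Nat.zero_le _)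
      (Finset.mem_univ j)
    show p j ≤ d + (k * (n + 1) * (m + d) + n)
    omega
  refine build_comb F hEfin.toFinset (hEfin.mem_toFinset.mpr (pot_zero_max hS))
    (fun p => potH S (pt p) - dot p (pt p)) (fun p => (xx (pt p)).1) (fun p => II (pt p))
    (fun p _ => hII _) (fun p hp => hM p (hEfin.mem_toFinset.mp hp)) ?_ ?_
  · intro p hp
    have hp := hEfin.mem_toFinset.mp hp
    have h1 := hdegp p hp
    have h2 : expDeg (p - II (pt p)) + expDeg (II (pt p)) = expDeg p := by
      rw [← expDeg_add, tsub_add_cancel_of_le (hM p hp)]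
    have h3 := hdeg (xx (pt p)).1
    have h4 : d ≤ k * (n + 1) * (m + d) + n := by
      have : m + d ≤ k * (n + 1) * (m + d) :=
        Nat.le_mul_of_pos_left _ (Nat.mul_pos hk (by omega))
      omega
    omega
  · intro p hp I hI hne
    have hp := hEfin.mem_toFinset.mp hp
    rw [hEfin.mem_toFinset]
    have h1 := (hst p hp).2.2 (shiftJ m (xx (pt p)).2 + I) (p - II (pt p) + I)
      ((F (xx (pt p)).1).coeff I) (by
        have e := tsub_add_cancel_of_le (hM p hp)
        calc p - II (pt p) + I + (shiftJ m (xx (pt p)).2 + II (pt p))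
            = (p - II (pt p) + II (pt p)) + (shiftJ m (xx (pt p)).2 + I) := by
              generalize p - II (pt p) = R
              abel
          _ = p + (shiftJ m (xx (pt p)).2 + I) := by rw [e]) (fun b => sumS_le F m C _ b hI) (by
        refine lt_of_le_of_lt (sumS_le F m C _ (pt p) (hII (pt p))) ?_
        have := hu (pt p) I hI hne
        rw [mono_eq, mono_eq] at this
        rw [dot_add, dot_add]
        linarith)
    exact ⟨h1.1, h1.2 _ (hpt _ h1.1)⟩

/-- **Tropical primary Nullstellensatz over ℝ∞** : a system `F = {f_1, …, f_k}` of
tropical polynomials in `n` variables over `ℝ∞`, each of degree at most `d ≥ 1`, has no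
root iff there is a nonsingular tropical algebraic combination `g` of `F` of degree at
most `N = 2(n+2)²·k·(4d)^{min(n,k)+2}` whose constant coefficient `g_0` is finite. -/
theorem tropical_primary_nullstellensatz_inf (n k d : ℕ) (hk : 1 ≤ k) (hd : 1 ≤ d)
    (F : Fin k → TropPoly n) (hdeg : ∀ j : Fin k, (F j).deg ≤ d) :
    (¬ ∃ a : Fin n → WithTop ℝ, ∀ j : Fin k, (F j).IsRootT a) ↔
      ∃ comb : TropComb n k,
        comb.DegLE F (2 * (n + 2) ^ 2 * k * (4 * d) ^ (min n k + 2)) ∧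
        comb.Nonsingular F ∧ comb.gCoeff F 0 ≠ ⊤ := by
  constructor
  · exact hard_dir n k d hk hd F hdeg
  · rintro ⟨comb, -, hns, h0⟩ ⟨a, ha⟩
    exact easy_dir F comb hns h0 a ha
end

section
/- Let m, n ≥ 1, let A be an m×n matrix with entries in ℝ∞ = ℝ ∪ {+∞} having no row and no column all of whose entries are +∞, and let S ⊆ {1, …, n}. Then exactly one of the following two statements holds: (1) there exists x ∈ ℝ∞^n which is a solution of the tropical linear system A ⊙ x and such that x_i is finite for every i ∈ S; (2) there exists z ∈ ℝ∞^m such that for every j ∈ {1, …, n} the minimum min_{1≤p≤m} (A_{pj} + z_p) either equals +∞ or is attained for exactly one index p, for any two distinct j, j′ with finite minimum the unique minimizing indices are distinct, and the j-th coordinate of A^T ⊙ z is finite for some j ∈ S. -/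
/-- The min-plus matrix-vector product over `ℝ∞ = ℝ ∪ {+∞}`:
`(A ⊙ x)_i = min_j (A_{ij} + x_j)`. -/
noncomputable def minPlusMul {m n : ℕ} (A : Fin m → Fin n → WithTop ℝ)
    (x : Fin n → WithTop ℝ) (i : Fin m) : WithTop ℝ :=
  Finset.univ.inf (fun j => A i j + x j)

/-- Strict inequality of vectors over `ℝ∞`: in every coordinate either both sides are
`+∞` or the strict inequality holds. -/
def ltVec {m : ℕ} (u v : Fin m → WithTop ℝ) : Prop :=
  ∀ i, (u i = ⊤ ∧ v i = ⊤) ∨ u i < v i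

section Helpers

theorem tld_fixed {m n : ℕ} (hm : 0 < m) (hn : 0 < n) (M : ℝ) (hM : 0 < M)
    (w : Fin n → Fin m → Fin n → ℝ) :
    ∃ x : Fin n → ℝ, (∀ j, x j ∈ Set.Icc (-M) M) ∧
      (∀ j, ∃ i, ∀ k, x j ≤ max (-M) (min M (w j i k + x k))) ∧
      (∀ j i, ∃ k, max (-M) (min M (w j i k + x k)) ≤ x j) := by
  have : Nonempty (Fin m) := ⟨⟨0, hm⟩⟩
  have : Nonempty (Fin n) := ⟨⟨0, hn⟩⟩
  have hMM : -M ≤ M := by linarith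
  have : Fact (-M ≤ M) := ⟨hMM⟩
  let f : (Fin n → Set.Icc (-M) M) →o (Fin n → Set.Icc (-M) M) :=
    { toFun := fun x j => ⨆ i, ⨅ k, Set.projIcc (-M) M hMM (w j i k + (x k : ℝ))
      monotone' := by
        intro x y hxy j
        refine iSup_mono fun i => iInf_mono fun k => Set.monotone_projIcc hMM ?_
        have : (x k : ℝ) ≤ y k := hxy k
        linarith }
  have hf : f (OrderHom.lfp f) = OrderHom.lfp f := OrderHom.map_lfp f
  set x := OrderHom.lfp f
  have hx : ∀ j, (⨆ i, ⨅ k, Set.projIcc (-M) M hMM (w j i k + (x k : ℝ))) = x j :=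
    fun j => congrFun hf j
  refine ⟨fun j => x j, fun j => (x j).2, ?_, ?_⟩
  · intro j
    obtain ⟨i, hi⟩ := exists_eq_ciSup_of_finite
      (f := fun i => ⨅ k, Set.projIcc (-M) M hMM (w j i k + (x k : ℝ)))
    refine ⟨i, fun k => ?_⟩
    have h : x j ≤ Set.projIcc (-M) M hMM (w j i k + (x k : ℝ)) := by
      rw [← hx j, ← hi]
      exact iInf_le _ k
    exact h
  · intro j i
    obtain ⟨k, hk⟩ := exists_eq_ciInf_of_finite
      (f := fun k => Set.projIcc (-M) M hMM (w j i k + (x k : ℝ)))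
    refine ⟨k, ?_⟩
    have h : Set.projIcc (-M) M hMM (w j i k + (x k : ℝ)) ≤ x j := by
      rw [← hx j, hk]
      exact le_iSup (fun i => ⨅ k, Set.projIcc (-M) M hMM (w j i k + (x k : ℝ))) i
    exact h

theorem tld_limit {m n : ℕ} (M : ℝ) (w : Fin n → Fin m → Fin n → ℝ) (j0 : Fin n)
    (H : ∀ N : ℕ, ∃ x : Fin n → ℝ, (∀ j, x j ∈ Set.Icc (-M) M) ∧ x j0 ≤ 0 ∧
      (∀ j i, ∃ k, max (-M) (min M (w j i k - 1 / ((N : ℝ) + 1) + x k)) ≤ x j)) :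
    ∃ x : Fin n → ℝ, (∀ j, x j ∈ Set.Icc (-M) M) ∧ x j0 ≤ 0 ∧
      (∀ j i, ∃ k, max (-M) (min M (w j i k + x k)) ≤ x j) := by
  choose x hx h0 hk using H
  have hc : IsCompact (Set.pi Set.univ (fun _ : Fin n => Set.Icc (-M) M)) :=
    isCompact_univ_pi fun _ => isCompact_Icc
  obtain ⟨y, hy, φ, hφ, hlim⟩ := hc.tendsto_subseq (x := x) (fun N => fun j _ => hx N j)
  refine ⟨y, fun j => hy j trivial, ?_, ?_⟩
  · have := (tendsto_pi_nhds.1 hlim) j0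
    exact le_of_tendsto' this (fun N => h0 _)
  · intro j i
    have hcl : IsClosed {q : ℝ × (Fin n → ℝ) |
        ∃ k, max (-M) (min M (w j i k - q.1 + q.2 k)) ≤ q.2 j} := by
      rw [Set.ofPred_exists]
      refine isClosed_iUnion_of_finite fun k => ?_
      refine isClosed_le (by fun_prop) (by fun_prop)
    have ht : Filter.Tendsto (fun N => ((1 / ((φ N : ℝ) + 1) : ℝ), x (φ N))) Filter.atTop
        (nhds ((0 : ℝ), y)) := by
      refine Filter.Tendsto.prodMk_nhds ?_ hlim
      exact (tendsto_one_div_add_atTop_nhds_zero_nat (𝕜 := ℝ)).comp hφ.tendsto_atTop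
    have := hcl.mem_of_tendsto ht (Filter.Eventually.of_forall fun N => hk (φ N) j i)
    simpa using this

theorem tld_gap {n : ℕ} (x : Fin n → ℝ) (a W : ℝ) (hW : 0 < W) :
    ∃ θ : ℝ, a ≤ θ ∧ θ ≤ a + n * W ∧ ∀ j, x j ≤ θ ∨ θ + W < x j := by
  by_contra hcon
  push Not at hcon
  have h : ∀ t : Fin (n + 1), ∃ j, a + (t : ℕ) * W < x j ∧ x j ≤ a + (t : ℕ) * W + W := by
    intro t
    have ht : ((t : ℕ) : ℝ) ≤ n := by exact_mod_cast Nat.lt_succ_iff.1 t.2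
    exact hcon (a + (t : ℕ) * W) (by nlinarith [(Nat.cast_nonneg (t : ℕ) : (0:ℝ) ≤ _)])
      (by nlinarith)
  choose g h1 h2 using h
  have key : ∀ s t : Fin (n + 1), s < t → g s ≠ g t := by
    intro s t hst he
    have : ((s : ℕ) : ℝ) + 1 ≤ (t : ℕ) := by exact_mod_cast hst
    have a1 := h1 t
    have a2 := h2 s
    rw [he] at a2
    nlinarith
  have hinj : Function.Injective g := by
    intro s t he
    rcases lt_trichotomy s t with h | h | h
    · exact (key _ _ h he).elim
    · exact h
    · exact (key _ _ h he.symm).elim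
  have := Fintype.card_le_of_injective g hinj
  simp at this

/-- A convenient form of the solution condition. -/
def tldSol {m n : ℕ} (A : Fin m → Fin n → WithTop ℝ) (x : Fin n → WithTop ℝ) : Prop :=
  ∀ i j, A i j + x j ≠ ⊤ → ∃ k, k ≠ j ∧ A i k + x k ≤ A i j + x j

theorem tld_mpm_le {m n : ℕ} (A : Fin m → Fin n → WithTop ℝ) (x : Fin n → WithTop ℝ)
    (i : Fin m) (j : Fin n) : minPlusMul A x i ≤ A i j + x j :=
  Finset.inf_le (f := fun j => A i j + x j) (Finset.mem_univ j)

theorem tld_mpm_att {m n : ℕ} (hn : 0 < n) (A : Fin m → Fin n → WithTop ℝ)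
    (x : Fin n → WithTop ℝ) (i : Fin m) : ∃ j, A i j + x j = minPlusMul A x i := by
  have : Nonempty (Fin n) := ⟨⟨0, hn⟩⟩
  obtain ⟨j, -, hj⟩ := Finset.exists_mem_eq_inf Finset.univ Finset.univ_nonempty
    (fun j => A i j + x j)
  exact ⟨j, hj.symm⟩

theorem tldSol.frozen {m n : ℕ} (hn : 0 < n) {A : Fin m → Fin n → WithTop ℝ}
    {x : Fin n → WithTop ℝ} (h : tldSol A x) (i : Fin m) : minPlusMul A x i = ⊤ ∨
          ∃ j₁ j₂ : Fin n, j₁ ≠ j₂ ∧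
            A i j₁ + x j₁ = minPlusMul A x i ∧ A i j₂ + x j₂ = minPlusMul A x i := by
  by_cases ht : minPlusMul A x i = ⊤
  · exact Or.inl ht
  · right
    obtain ⟨j, hj⟩ := tld_mpm_att hn A x i
    obtain ⟨k, hkj, hk⟩ := h i j (by rwa [hj])
    exact ⟨j, k, hkj.symm, hj, le_antisymm (hj ▸ hk) (tld_mpm_le A x i k)⟩

theorem tldSol_inf {m n : ℕ} (hn : 0 < n) {A : Fin m → Fin n → WithTop ℝ}
    (y : Fin n → Fin n → WithTop ℝ) (h : ∀ s, tldSol A (y s)) :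
    tldSol A (fun j => Finset.univ.inf (fun s => y s j)) := by
  have : Nonempty (Fin n) := ⟨⟨0, hn⟩⟩
  intro i j hj
  obtain ⟨s, -, hs⟩ := Finset.exists_mem_eq_inf Finset.univ Finset.univ_nonempty
    (fun s => y s j)
  simp only [hs] at hj ⊢
  obtain ⟨k, hkj, hk⟩ := h s i j hj
  refine ⟨k, hkj, le_trans ?_ hk⟩
  gcongr
  exact Finset.inf_le (f := fun s => y s k) (Finset.mem_univ s)

/-- The strict dual certificate at a column. -/
def tldDual {m n : ℕ} (A : Fin m → Fin n → WithTop ℝ) (j0 : Fin n) : Prop :=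
  ∃ (R : Set (Fin n)) (σ : Fin n → Fin m) (u : Fin n → ℝ) , j0 ∈ R ∧
    ∀ j ∈ R, A (σ j) j ≠ ⊤ ∧ ∀ k, k ≠ j → A (σ j) k ≠ ⊤ →
      k ∈ R ∧ u j + (A (σ j) j).untopD 0 < (A (σ j) k).untopD 0 + u k

theorem tld_dichotomy {m n : ℕ} (hm : 0 < m) (hn : 0 < n) (A : Fin m → Fin n → WithTop ℝ)
    (j0 : Fin n) : (∃ x, tldSol A x ∧ x j0 ≠ ⊤) ∨ tldDual A j0 := by
  classical
  let a : Fin m → Fin n → ℝ := fun i j => (A i j).untopD 0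
  obtain ⟨W, hW, hWb⟩ : ∃ W : ℝ, 0 < W ∧ ∀ i j k, |a i k - a i j| ≤ W := by
    refine ⟨1 + ∑ i, ∑ j, ∑ k, |a i k - a i j|, by positivity, fun i j k => ?_⟩
    have h1 : |a i k - a i j| ≤ ∑ k, |a i k - a i j| :=
      Finset.single_le_sum (f := fun k => |a i k - a i j|) (fun _ _ => abs_nonneg _)
        (Finset.mem_univ k)
    have h2 : ∑ k, |a i k - a i j| ≤ ∑ j, ∑ k, |a i k - a i j| :=
      Finset.single_le_sum (f := fun j => ∑ k, |a i k - a i j|)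
        (fun _ _ => by positivity) (Finset.mem_univ j)
    have h3 : ∑ j, ∑ k, |a i k - a i j| ≤ ∑ i, ∑ j, ∑ k, |a i k - a i j| :=
      Finset.single_le_sum (f := fun i => ∑ j, ∑ k, |a i k - a i j|)
        (fun _ _ => by positivity) (Finset.mem_univ i)
    linarith
  obtain ⟨M, hMdef⟩ : ∃ M : ℝ, M = n * W + W := ⟨_, rfl⟩
  have hM : 0 < M := by rw [hMdef]; positivity
  let w : Fin n → Fin m → Fin n → ℝ := fun j i k =>
    if A i j = ⊤ then -(2 * M) else if k = j ∨ A i k = ⊤ then 2 * M else a i k - a i j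
  by_cases H : ∀ N : ℕ, ∃ x : Fin n → ℝ, (∀ j, x j ∈ Set.Icc (-M) M) ∧ x j0 ≤ 0 ∧
      (∀ j i, ∃ k, max (-M) (min M (w j i k - 1 / ((N : ℝ) + 1) + x k)) ≤ x j)
  · left
    obtain ⟨x, hx, hx0, hs⟩ := tld_limit M w j0 H
    obtain ⟨θ, hθ0, hθ1, hgap⟩ := tld_gap x 0 W hW
    refine ⟨fun j => if x j ≤ θ then (x j : WithTop ℝ) else ⊤, ?_, ?_⟩
    · intro i j hij
      by_cases hj : x j ≤ θ
      · simp only [hj, if_true] at hij ⊢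
        have hAij : A i j ≠ ⊤ := fun h => hij (by simp [h])
        obtain ⟨k, hk⟩ := hs j i
        have hk1 : w j i k + x k ≤ x j := by
          have h1 := le_trans (le_max_right _ _) hk
          rcases min_le_iff.1 h1 with h | h
          · linarith
          · exact h
        have hxk := (hx k).1
        by_cases hc : k = j ∨ A i k = ⊤
        · simp only [w, hAij, hc, if_true, if_false] at hk1
          linarith
        · simp only [w, hAij, hc, if_false] at hk1
          push Not at hc
          have hb := abs_le.1 (hWb i j k)
          have hkθ : x k ≤ θ := by
            rcases hgap k with h | h
            · exact h
            · linarith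
          refine ⟨k, hc.1, ?_⟩
          simp only [hkθ, if_true]
          have e1 : A i k = ((a i k : ℝ) : WithTop ℝ) := by
            lift A i k to ℝ using hc.2 with r hr
            simp [a, ← hr]
          have e2 : A i j = ((a i j : ℝ) : WithTop ℝ) := by
            lift A i j to ℝ using hAij with r hr
            simp [a, ← hr]
          rw [e1, e2]
          norm_cast
          linarith
      · simp [hj] at hij
    · have : x j0 ≤ θ := by linarith
      simp [this]
  · right
    push Not at H
    obtain ⟨N, hN⟩ := H
    obtain ⟨x, hx, hsub, hsup⟩ := tld_fixed hm hn M hM (fun j i k => w j i k - 1 / ((N : ℝ) + 1))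
    have hε : 0 < 1 / ((N : ℝ) + 1) := by positivity
    set ε := 1 / ((N : ℝ) + 1)
    have hx0 : 0 < x j0 := by
      by_contra h
      obtain ⟨j, i, hji⟩ := hN x hx (not_lt.1 h)
      obtain ⟨k, hk⟩ := hsup j i
      exact absurd hk (not_le.2 (hji k))
    obtain ⟨θ, hθ0, hθ1, hgap⟩ := tld_gap x (-M) W hW
    choose σ hσ using hsub
    refine ⟨{j | θ < x j}, σ, x, ?_, ?_⟩
    · show θ < x j0
      linarith
    · intro j hj
      have hj : θ < x j := hj
      have hj' : θ + W < x j := (hgap j).resolve_left (not_le.2 hj)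
      have h1 : ∀ k, x j ≤ w j (σ j) k - ε + x k := by
        intro k
        rcases le_max_iff.1 (hσ j k) with h | h
        · linarith
        · exact le_trans h (min_le_right _ _)
      have hA : A (σ j) j ≠ ⊤ := by
        intro h
        have h2 := h1 j
        simp only [w, h, if_true] at h2
        have := (hx j).2
        linarith
      refine ⟨hA, fun k hkj hAk => ?_⟩
      have h2 := h1 k
      simp only [w, hA, hkj, hAk, or_self, if_false] at h2
      have hb := abs_le.1 (hWb (σ j) j k)
      refine ⟨?_, ?_⟩
      · show θ < x k
        linarith
      · show x j + a (σ j) j < a (σ j) k + x k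
        linarith

theorem tld_dual_frozen {m n : ℕ} (hm : 0 < m) (A : Fin m → Fin n → WithTop ℝ) (j0 : Fin n)
    (h : tldDual A j0) : ∃ z : Fin m → WithTop ℝ,
        (∀ j : Fin n, minPlusMul (fun j i => A i j) z j = ⊤ ∨
          ∃! p : Fin m, A p j + z p = minPlusMul (fun j i => A i j) z j) ∧
        (∀ j j' : Fin n, j ≠ j' →
          minPlusMul (fun j i => A i j) z j ≠ ⊤ →
          minPlusMul (fun j i => A i j) z j' ≠ ⊤ →
          ∀ p : Fin m, A p j + z p = minPlusMul (fun j i => A i j) z j →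
            A p j' + z p ≠ minPlusMul (fun j i => A i j) z j') ∧
        minPlusMul (fun j i => A i j) z j0 ≠ ⊤ := by
  classical
  obtain ⟨R, σ, u, hj0, hR⟩ := h
  have hinj : ∀ j ∈ R, ∀ k ∈ R, σ j = σ k → j = k := by
    intro j hj k hk he
    by_contra hne
    have h1 := ((hR j hj).2 k (Ne.symm hne) (he ▸ (hR k hk).1)).2
    have h2 := ((hR k hk).2 j hne (he ▸ (hR j hj).1)).2
    rw [he] at h1
    linarith
  have hcoe : ∀ i j, A i j ≠ ⊤ → A i j = (((A i j).untopD 0 : ℝ) : WithTop ℝ) := by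
    intro i j hij
    lift A i j to ℝ using hij with r hr
    simp
  obtain ⟨z, hz1, hz2⟩ : ∃ z : Fin m → WithTop ℝ,
      (∀ j ∈ R, z (σ j) = ((-((A (σ j) j).untopD 0) - u j : ℝ) : WithTop ℝ)) ∧
      (∀ p, z p ≠ ⊤ → ∃ j ∈ R, σ j = p) := by
    refine ⟨fun p => if h : ∃ j ∈ R, σ j = p then
      ((-((A p h.choose).untopD 0) - u h.choose : ℝ) : WithTop ℝ) else ⊤, ?_, ?_⟩
    · intro j hj
      have h : ∃ k ∈ R, σ k = σ j := ⟨j, hj, rfl⟩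
      have e : h.choose = j := hinj _ h.choose_spec.1 _ hj h.choose_spec.2
      simp only [dif_pos h, e]
    · intro p hp
      by_contra h
      exact hp (dif_neg h)
  have hval : ∀ k ∈ R, A (σ k) k + z (σ k) = ((-u k : ℝ) : WithTop ℝ) := by
    intro k hk
    rw [hz1 k hk, hcoe _ _ (hR k hk).1]
    norm_cast
    simp only [WithTop.untopD_coe]
    ring
  have hgt : ∀ k ∈ R, ∀ p, p ≠ σ k → ((-u k : ℝ) : WithTop ℝ) < A p k + z p := by
    intro k hk p hp
    by_cases ht : A p k + z p = ⊤
    · rw [ht]; exact WithTop.coe_lt_top _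
    · have hA : A p k ≠ ⊤ := fun h => ht (by simp [h])
      have hz : z p ≠ ⊤ := fun h => ht (by simp [h])
      obtain ⟨j, hj, rfl⟩ := hz2 p hz
      have hjk : k ≠ j := fun h => hp (by rw [h])
      have h2 := ((hR j hj).2 k hjk hA).2
      rw [hz1 j hj, hcoe _ _ hA]
      norm_cast
      linarith
  have hmin : ∀ k ∈ R, minPlusMul (fun j i => A i j) z k = ((-u k : ℝ) : WithTop ℝ) := by
    intro k hk
    apply le_antisymm
    · rw [← hval k hk]
      exact tld_mpm_le (fun j i => A i j) z k (σ k)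
    · obtain ⟨p, hp⟩ := tld_mpm_att hm (fun j i => A i j) z k
      rw [← hp]
      by_cases h : p = σ k
      · rw [h]; exact (hval k hk).ge
      · exact (hgt k hk p h).le
  have hmem : ∀ k, minPlusMul (fun j i => A i j) z k ≠ ⊤ → k ∈ R := by
    intro k hk
    obtain ⟨p, hp⟩ := tld_mpm_att hm (fun j i => A i j) z k
    rw [← hp] at hk
    have hA : A p k ≠ ⊤ := fun h => hk (by simp [h])
    have hz : z p ≠ ⊤ := fun h => hk (by simp [h])
    obtain ⟨j, hj, rfl⟩ := hz2 p hz
    by_cases h : k = j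
    · rwa [h]
    · exact ((hR j hj).2 k h hA).1
  have huniq : ∀ k ∈ R, ∀ p, A p k + z p = minPlusMul (fun j i => A i j) z k → p = σ k := by
    intro k hk p hp
    by_contra h
    have := hgt k hk p h
    rw [hp, hmin k hk] at this
    exact lt_irrefl _ this
  refine ⟨z, ?_, ?_, ?_⟩
  · intro j
    by_cases h : minPlusMul (fun j i => A i j) z j = ⊤
    · exact Or.inl h
    · have hj := hmem j h
      exact Or.inr ⟨σ j, by simp only [hval j hj, hmin j hj], fun p hp => huniq j hj p hp⟩
  · intro j j' hne h1 h2 p hp hp'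
    have e1 := huniq j (hmem j h1) p hp
    have e2 := huniq j' (hmem j' h2) p hp'
    exact hne (hinj _ (hmem j h1) _ (hmem j' h2) (e1.symm.trans e2))
  · rw [hmin j0 hj0]; exact WithTop.coe_ne_top

theorem tld_excl {m n : ℕ} (hm : 0 < m) (A : Fin m → Fin n → WithTop ℝ)
    (x : Fin n → WithTop ℝ)
    (hx : ∀ i : Fin m, minPlusMul A x i = ⊤ ∨
          ∃ j₁ j₂ : Fin n, j₁ ≠ j₂ ∧
            A i j₁ + x j₁ = minPlusMul A x i ∧ A i j₂ + x j₂ = minPlusMul A x i)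
    (z : Fin m → WithTop ℝ)
    (hz2 : ∀ j j' : Fin n, j ≠ j' →
          minPlusMul (fun j i => A i j) z j ≠ ⊤ →
          minPlusMul (fun j i => A i j) z j' ≠ ⊤ →
          ∀ p : Fin m, A p j + z p = minPlusMul (fun j i => A i j) z j →
            A p j' + z p ≠ minPlusMul (fun j i => A i j) z j')
    (j0 : Fin n) (h1 : x j0 ≠ ⊤) (h2 : minPlusMul (fun j i => A i j) z j0 ≠ ⊤) : False := by
  classical
  set y := minPlusMul (fun j i => A i j) z with hy
  obtain ⟨j, hj, hjmin⟩ := Finset.exists_min_image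
    (Finset.univ.filter fun j => x j ≠ ⊤ ∧ y j ≠ ⊤) (fun j => x j + y j) ⟨j0, by simp [h1, h2]⟩
  simp only [Finset.mem_filter, Finset.mem_univ, true_and] at hj hjmin
  obtain ⟨p, hp⟩ := tld_mpm_att hm (fun j i => A i j) z j
  rw [← hy] at hp
  have hpt : A p j + z p ≠ ⊤ := hp ▸ hj.2
  have hA : A p j ≠ ⊤ := fun h => hpt (by simp [h])
  have hzp : z p ≠ ⊤ := fun h => hpt (by simp [h])
  have hle := tld_mpm_le A x p j
  have hfin : A p j + x j ≠ ⊤ := WithTop.add_ne_top.2 ⟨hA, hj.1⟩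
  have claim : ∀ k, A p k + x k = minPlusMul A x p → k = j := by
    intro k hk
    by_contra hkj
    have hk' : A p k + x k ≤ A p j + x j := hk ▸ hle
    obtain ⟨hAk, hxk⟩ := WithTop.add_ne_top.1 (ne_top_of_le_ne_top hfin hk')
    have hyk : y k ≤ A p k + z p := tld_mpm_le (fun j i => A i j) z k p
    have hykt : y k ≠ ⊤ := ne_top_of_le_ne_top (WithTop.add_ne_top.2 ⟨hAk, hzp⟩) hyk
    have hne := hz2 j k (Ne.symm hkj) hj.2 hykt p hp
    have hlt : y k < A p k + z p := lt_of_le_of_ne hyk (Ne.symm hne)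
    have hm' := hjmin k ⟨hxk, hykt⟩
    obtain ⟨apk, e1⟩ := WithTop.ne_top_iff_exists.1 hAk
    obtain ⟨apj, e2⟩ := WithTop.ne_top_iff_exists.1 hA
    obtain ⟨zp, e3⟩ := WithTop.ne_top_iff_exists.1 hzp
    obtain ⟨xk, e4⟩ := WithTop.ne_top_iff_exists.1 hxk
    obtain ⟨xj, e5⟩ := WithTop.ne_top_iff_exists.1 hj.1
    obtain ⟨yk, e6⟩ := WithTop.ne_top_iff_exists.1 hykt
    obtain ⟨yj, e7⟩ := WithTop.ne_top_iff_exists.1 hj.2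
    rw [← e1, ← e2, ← e4, ← e5] at hk'
    rw [← e6, ← e1, ← e3] at hlt
    rw [← e5, ← e7, ← e4, ← e6] at hm'
    rw [← e2, ← e3, ← e7] at hp
    norm_cast at hk' hlt hm' hp
    linarith
  rcases hx p with h | ⟨k1, k2, hne, hk1, hk2⟩
  · rw [h] at hle
    exact hfin (top_le_iff.1 hle)
  · exact hne ((claim k1 hk1).trans (claim k2 hk2).symm)

end Helpers

/-- **Tropical linear duality over ℝ∞** : for a matrix `A` over `ℝ∞` with no infinite row
or column and a subset `S` of columns, exactly one of the following holds:
(1) the tropical linear system `A ⊙ x` has a solution `x` with `x_i` finite for every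
`i ∈ S`; (2) there is `z` such that in each column `j` the minimum `min_p (A_{pj} + z_p)`
is `+∞` or attained exactly once, minimizers of distinct columns with finite minima are
distinct, and the `j`-th coordinate of `Aᵀ ⊙ z` is finite for some `j ∈ S`. -/
theorem tropical_linear_duality (m n : ℕ) (hm : 0 < m) (hn : 0 < n)
    (A : Fin m → Fin n → WithTop ℝ)
    (hrow : ∀ i : Fin m, ∃ j : Fin n, A i j ≠ ⊤)
    (hcol : ∀ j : Fin n, ∃ i : Fin m, A i j ≠ ⊤)
    (S : Set (Fin n)) :
    Xor'
      (∃ x : Fin n → WithTop ℝ,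
        (∀ i : Fin m, minPlusMul A x i = ⊤ ∨
          ∃ j₁ j₂ : Fin n, j₁ ≠ j₂ ∧
            A i j₁ + x j₁ = minPlusMul A x i ∧ A i j₂ + x j₂ = minPlusMul A x i) ∧
        ∀ i ∈ S, x i ≠ ⊤)
      (∃ z : Fin m → WithTop ℝ,
        (∀ j : Fin n, minPlusMul (fun j i => A i j) z j = ⊤ ∨
          ∃! p : Fin m, A p j + z p = minPlusMul (fun j i => A i j) z j) ∧
        (∀ j j' : Fin n, j ≠ j' →
          minPlusMul (fun j i => A i j) z j ≠ ⊤ →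
          minPlusMul (fun j i => A i j) z j' ≠ ⊤ →
          ∀ p : Fin m, A p j + z p = minPlusMul (fun j i => A i j) z j →
            A p j' + z p ≠ minPlusMul (fun j i => A i j) z j') ∧
        ∃ j ∈ S, minPlusMul (fun j i => A i j) z j ≠ ⊤) := by
  classical
  by_cases H : ∀ s ∈ S, ∃ x, tldSol A x ∧ x s ≠ ⊤
  · left
    have H' : ∀ s, ∃ x, tldSol A x ∧ (s ∈ S → x s ≠ ⊤) := by
      intro s
      by_cases hs : s ∈ S
      · obtain ⟨x, h1, h2⟩ := H s hs
        exact ⟨x, h1, fun _ => h2⟩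
      · exact ⟨fun _ => ⊤, fun i j h => absurd (by simp) h, fun h => absurd h hs⟩
    choose y hy1 hy2 using H'
    have hfin : ∀ s ∈ S, Finset.univ.inf (fun t => y t s) ≠ ⊤ := fun s hs =>
      ne_top_of_le_ne_top (hy2 s hs)
        (Finset.inf_le (f := fun t => y t s) (Finset.mem_univ s))
    have hsol := fun i => tldSol.frozen hn (tldSol_inf hn y hy1) i
    refine ⟨⟨_, hsol, hfin⟩, ?_⟩
    rintro ⟨z, -, hz2, j, hjS, hj⟩
    exact tld_excl hm A _ hsol z hz2 j (hfin j hjS) hj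
  · right
    push Not at H
    obtain ⟨s, hs, hno⟩ := H
    have hd : tldDual A s := by
      rcases tld_dichotomy hm hn A s with ⟨x, h1, h2⟩ | h
      · exact absurd (hno x h1) h2
      · exact h
    obtain ⟨z, hz1, hz2, hz3⟩ := tld_dual_frozen hm A s hd
    refine ⟨⟨z, hz1, hz2, s, hs, hz3⟩, ?_⟩
    rintro ⟨x, hx, hxS⟩
    exact tld_excl hm A x hx z hz2 s (hxS s hs) hz3
end
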